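/- Let L be an affine subspace of ℝ^n. (a) If L is extremal and f : U → L, U ⊂ ℝ^d open, is a smooth map which is nondegenerate in L, then f (viewed as a map into ℝ^n) is extremal. (b) If L is not extremal, then every point of L is VWA. -/

import Mathlib

open MeasureTheory

/-- `y ∈ W_v(1,n)`: infinitely many `q ∈ ℤ^n` with `|y·q + p| ≤ ‖q‖^{-v}` for some `p ∈ ℤ`. -/
def InW {n : ℕ} (y : Fin n → ℝ) (v : ℝ) : Prop :=
  {q : Fin n → ℤ | ∃ p : ℤ,
    |(∑ i, y i * (q i : ℝ)) + (p : ℝ)| ≤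
      ‖(fun i => (q i : ℝ) : Fin n → ℝ)‖ ^ (-v)}.Infinite

/-- `y` is very well approximable. -/
def IsVWA {n : ℕ} (y : Fin n → ℝ) : Prop :=
  ∃ v : ℝ, (n : ℝ) < v ∧ InW y v

/-- `f` is extremal on `U`: `f x` is not VWA for a.e. `x ∈ U`. -/
def IsExtremal {α : Type*} [MeasureSpace α] {n : ℕ} (U : Set α) (f : α → Fin n → ℝ) : Prop :=
  volume {x ∈ U | IsVWA (f x)} = 0

/-- An affine subspace of `ℝ^n` is extremal if any (equivalently, one) injective affine
parametrization of it is an extremal map. -/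
def AffineExtremal {n : ℕ} (L : AffineSubspace ℝ (Fin n → ℝ)) : Prop :=
  ∀ (s : ℕ) (h : (Fin s → ℝ) →ᵃ[ℝ] (Fin n → ℝ)), Function.Injective h →
    Set.range h = (L : Set (Fin n → ℝ)) → IsExtremal Set.univ (fun x => h x)

/-- `f : U → L` is nondegenerate in `L` at `x`: for some `l`, the partial derivatives of `f`
at `x` of order up to `l` span the linear part of `L`. -/
def NondegAt {d n : ℕ} (U : Set (Fin d → ℝ)) (L : AffineSubspace ℝ (Fin n → ℝ))
    (f : (Fin d → ℝ) → Fin n → ℝ) (x : Fin d → ℝ) : Prop :=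
  ∃ l : ℕ, Submodule.span ℝ
      {y : Fin n → ℝ | ∃ m : ℕ, 1 ≤ m ∧ m ≤ l ∧
        ∃ u : Fin m → (Fin d → ℝ), y = iteratedFDerivWithin ℝ m f U x u} = L.direction

/-- `x` is marked by a finite chain of `T` on which `ψ` takes values in `[ε, ρ)`, while `ψ` is at
least `ρ` on all other elements of `T` comparable with the whole chain. -/
def Marked {ι : Type*} [PartialOrder ι] (ψ : ι → ℝ → ℝ) (ρ ε : ℝ) (T : Set ι) (x : ℝ) : Prop :=
  ∃ F : Finset ι, (F : Set ι) ⊆ T ∧ IsChain (· ≤ ·) (F : Set ι) ∧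
    (∀ s ∈ F, ε ≤ ψ s x ∧ ψ s x < ρ) ∧
    ∀ s ∈ T, s ∉ F → (∀ r ∈ F, s ≤ r ∨ r ≤ s) → ρ ≤ ψ s x

/-- The constant of the nondivergence estimate for posets of length `k`. -/
def nondivConst (N : ℕ) : ℕ → ℕ
  | 0 => 0
  | k + 1 => N * (nondivConst N k + 1)

theorem Marked.of_insert {ι : Type*} [PartialOrder ι] {ψ : ι → ℝ → ℝ} {ρ ε : ℝ} {T : Set ι} {x : ℝ}
    {s : ι} (hs : s ∈ T) (h1 : ε ≤ ψ s x) (h2 : ψ s x < ρ)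
    (h : Marked ψ ρ ε {r ∈ T | r ≠ s ∧ (r ≤ s ∨ s ≤ r)} x) : Marked ψ ρ ε T x := by
  classical
  obtain ⟨F, hFT, hF, hval, hout⟩ := h
  refine ⟨insert s F, ?_, ?_, ?_, ?_⟩
  · rw [Finset.coe_insert, Set.insert_subset_iff]
    exact ⟨hs, fun r hr => (hFT hr).1⟩
  · rw [Finset.coe_insert]
    exact hF.insert fun b hb _ => (hFT hb).2.2.symm
  · intro r hr
    rcases Finset.mem_insert.1 hr with rfl | hr
    · exact ⟨h1, h2⟩
    · exact hval r hr
  · intro r hrT hrF hcomp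
    simp only [Finset.mem_insert, not_or] at hrF
    exact hout r ⟨hrT, hrF.1, hcomp s (Finset.mem_insert_self _ _)⟩ hrF.2
      fun q hq => hcomp q (Finset.mem_insert_of_mem hq)

/-- Quantitative nondivergence for a family of functions on an interval, indexed by a poset of
finite length. -/
theorem volume_not_marked_le {ι : Type*} [PartialOrder ι] {N : ℕ} {τ : ℝ} (hτ : 1 < τ)
    (hN : IsEmpty (Besicovitch.SatelliteConfig ℝ N τ)) (ψ : ι → ℝ → ℝ) {ρ ε : ℝ} {κ : ENNReal} :
    ∀ (k : ℕ) (T : Set ι) (a b : ℝ), a < b →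
      (∀ F : Finset ι, (F : Set ι) ⊆ T → IsChain (· ≤ ·) (F : Set ι) → F.card ≤ k) →
      (∀ s ∈ T, ContinuousOn (ψ s) (Set.Icc a b)) →
      (∀ s ∈ T, ∃ x ∈ Set.Icc a b, ρ ≤ ψ s x) →
      (∀ x ∈ Set.Icc a b, {s ∈ T | ψ s x < ρ}.Finite) →
      (∀ s ∈ T, ∀ a' b', a ≤ a' → a' < b' → b' ≤ b → (∃ x ∈ Set.Icc a' b', ρ ≤ ψ s x) →
        volume {x ∈ Set.Icc a' b' | ψ s x < ε} ≤ κ * volume (Set.Icc a' b')) →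
      volume {x ∈ Set.Icc a b | ¬ Marked ψ ρ ε T x} ≤
        nondivConst N k * κ * volume (Set.Icc a b) := by
  intro k
  induction k with
  | zero =>
    intro T a b _ hchain _ _ _ _
    have hT : ∀ s, s ∉ T := by
      intro s hs
      have := hchain {s} (by simpa using hs) (by simp)
      simp at this
    have : {x ∈ Set.Icc a b | ¬ Marked ψ ρ ε T x} = ∅ := by
      refine Set.eq_empty_of_forall_notMem fun x hx => hx.2 ?_
      exact ⟨∅, by simp, by simp, by simp, fun s hs => absurd hs (hT s)⟩
    rw [this, measure_empty]; exact zero_le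
  | succ k ih =>
    intro T a b hab hchain hcont hsup hfin hgood
    set E := {x ∈ Set.Icc a b | ¬ Marked ψ ρ ε T x} with hE
    let K : ι → Set ℝ := fun s => {x ∈ Set.Icc a b | ρ ≤ ψ s x}
    have hKc : ∀ s ∈ T, IsCompact (K s) := by
      intro s hs
      refine isCompact_Icc.of_isClosed_subset ?_ (Set.sep_subset _ _)
      exact (hcont s hs).preimage_isClosed_of_isClosed isClosed_Icc isClosed_Ici
    have hKn : ∀ s ∈ T, (K s).Nonempty := fun s hs => by
      obtain ⟨x, hx, hx'⟩ := hsup s hs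
      exact ⟨x, hx, hx'⟩
    have hmax : ∀ y : E, ∃ s ∈ T, ψ s y < ρ ∧ ∀ s' ∈ T, ψ s' y < ρ →
        Metric.infDist (y : ℝ) (K s') ≤ Metric.infDist (y : ℝ) (K s) := by
      rintro ⟨y, hyI, hyM⟩
      have hne : {s ∈ T | ψ s y < ρ}.Nonempty := by
        by_contra hcon
        rw [Set.not_nonempty_iff_eq_empty] at hcon
        refine hyM ⟨∅, by simp, by simp, by simp, fun s hs _ _ => ?_⟩
        by_contra hlt
        exact (Set.eq_empty_iff_forall_notMem.1 hcon s) ⟨hs, not_le.1 hlt⟩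
      obtain ⟨s, hs, hs'⟩ := Set.exists_max_image _ (fun s => Metric.infDist y (K s))
        (hfin y hyI) hne
      exact ⟨s, hs.1, hs.2, fun s' h1 h2 => hs' s' ⟨h1, h2⟩⟩
    choose σ hσT hσρ hσmax using hmax
    let r : E → ℝ := fun y => Metric.infDist (y : ℝ) (K (σ y))
    have hr0 : ∀ y, 0 < r y := fun y =>
      ((hKc _ (hσT y)).isClosed.notMem_iff_infDist_pos (hKn _ (hσT y))).1
        fun h => absurd h.2 (not_le.2 (hσρ y))
    have hrle : ∀ y, r y ≤ b - a := fun y => by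
      obtain ⟨x, hx⟩ := hKn _ (hσT y)
      refine (Metric.infDist_le_dist_of_mem hx).trans ?_
      exact Real.dist_le_of_mem_Icc y.2.1 hx.1
    have hlocal : ∀ y : E, volume (E ∩ Metric.ball (y : ℝ) (r y)) ≤
        (nondivConst N k + 1) * κ * volume (Metric.closedBall (y : ℝ) (r y) ∩ Set.Icc a b) := by
      intro y
      have hya := y.2.1.1
      have hyb := y.2.1.2
      have hry := hr0 y
      have hJ : Metric.closedBall (y : ℝ) (r y) ∩ Set.Icc a b =
          Set.Icc (max (y - r y) a) (min (y + r y) b) := by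
        rw [Real.closedBall_eq_Icc, Set.Icc_inter_Icc]
      rw [hJ]
      have ha' : a ≤ max ((y : ℝ) - r y) a := le_max_right _ _
      have hb' : min ((y : ℝ) + r y) b ≤ b := min_le_right _ _
      have hab' : max ((y : ℝ) - r y) a < min ((y : ℝ) + r y) b := by
        refine max_lt (lt_min (by linarith) (by linarith)) (lt_min (by linarith) hab)
      set a' := max ((y : ℝ) - r y) a
      set b' := min ((y : ℝ) + r y) b
      have hsub : Set.Icc a' b' ⊆ Set.Icc a b := Set.Icc_subset_Icc ha' hb'
      have hsupJ : ∀ s ∈ T, ∃ x ∈ Set.Icc a' b', ρ ≤ ψ s x := by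
        intro s hs
        rw [← hJ]
        by_cases hys : ψ s y < ρ
        · obtain ⟨x, hx, hxd⟩ := (hKc s hs).exists_infDist_eq_dist (hKn s hs) (y : ℝ)
          refine ⟨x, ⟨?_, hx.1⟩, hx.2⟩
          rw [Metric.mem_closedBall, dist_comm, ← hxd]
          exact hσmax y s hs hys
        · exact ⟨y, ⟨Metric.mem_closedBall_self hry.le, y.2.1⟩, not_lt.1 hys⟩
      set T' := {q ∈ T | q ≠ σ y ∧ (q ≤ σ y ∨ σ y ≤ q)}
      have hcover : E ∩ Metric.ball (y : ℝ) (r y) ⊆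
          {x ∈ Set.Icc a' b' | ¬ Marked ψ ρ ε T' x} ∪ {x ∈ Set.Icc a' b' | ψ (σ y) x < ε} := by
        rintro x ⟨hxE, hxb⟩
        have hxJ : x ∈ Set.Icc a' b' := by
          rw [← hJ]
          exact ⟨Metric.ball_subset_closedBall hxb, hxE.1⟩
        by_contra hcon
        simp only [Set.mem_union, Set.mem_ofPred_eq, not_or, not_and, not_not, not_lt] at hcon
        refine hxE.2 (Marked.of_insert (hσT y) (hcon.2 hxJ) ?_ (hcon.1 hxJ))
        by_contra hge
        have : r y ≤ dist (y : ℝ) x :=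
          Metric.infDist_le_dist_of_mem ⟨hxE.1, not_lt.1 hge⟩
        rw [Metric.mem_ball, dist_comm] at hxb
        linarith
      have hih := ih T' a' b' hab' ?_ (fun s hs => (hcont s hs.1).mono hsub)
        (fun s hs => hsupJ s hs.1)
        (fun x hx => (hfin x (hsub hx)).subset fun s hs => ⟨hs.1.1, hs.2⟩)
        (fun s hs a'' b'' h1 h2 h3 => hgood s hs.1 a'' b'' (ha'.trans h1) h2 (h3.trans hb'))
      · calc volume (E ∩ Metric.ball (y : ℝ) (r y))
            ≤ nondivConst N k * κ * volume (Set.Icc a' b') + κ * volume (Set.Icc a' b') :=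
              (measure_mono hcover).trans ((measure_union_le _ _).trans (add_le_add hih
                (hgood _ (hσT y) a' b' ha' hab' hb' (hsupJ _ (hσT y)))))
          _ = _ := by ring
      · intro F hF hFc
        classical
        have hnot : σ y ∉ F := fun h => (hF h).2.1 rfl
        have := hchain (insert (σ y) F) ?_ ?_
        · rw [Finset.card_insert_of_notMem hnot] at this
          omega
        · rw [Finset.coe_insert, Set.insert_subset_iff]
          exact ⟨hσT y, fun q hq => (hF hq).1⟩
        · rw [Finset.coe_insert]
          exact hFc.insert fun q hq _ => (hF hq).2.2.symm
    let q : Besicovitch.BallPackage E ℝ :=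
      { c := fun y => y, r := r, rpos := hr0, r_bound := b - a, r_le := hrle }
    obtain ⟨S, hSd, hSc⟩ := Besicovitch.exist_disjoint_covering_families hτ hN q
    have hcount : ∀ i, (S i).Countable := fun i => by
      refine (hSd i).countable_of_nonempty_interior fun y _ => ?_
      exact ⟨y, Metric.ball_subset_interior_closedBall (Metric.mem_ball_self (hr0 y))⟩
    have hfam : ∀ i, volume (⋃ y ∈ S i, E ∩ Metric.ball (y : ℝ) (r y)) ≤
        (nondivConst N k + 1) * κ * volume (Set.Icc a b) := by
      intro i
      calc volume (⋃ y ∈ S i, E ∩ Metric.ball (y : ℝ) (r y))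
          ≤ ∑' y : S i, volume (E ∩ Metric.ball ((y : E) : ℝ) (r y)) :=
            measure_biUnion_le _ (hcount i) _
        _ ≤ ∑' y : S i, (nondivConst N k + 1) * κ *
              volume (Metric.closedBall ((y : E) : ℝ) (r y) ∩ Set.Icc a b) :=
            ENNReal.tsum_le_tsum fun y => hlocal y
        _ = (nondivConst N k + 1) * κ *
              volume (⋃ y ∈ S i, Metric.closedBall (y : ℝ) (r y) ∩ Set.Icc a b) := by
            rw [ENNReal.tsum_mul_left, measure_biUnion (hcount i)]
            · exact fun x hx y hy hxy => ((hSd i) hx hy hxy).mono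
                Set.inter_subset_left Set.inter_subset_left
            · exact fun y _ => measurableSet_closedBall.inter measurableSet_Icc
        _ ≤ _ := by
            gcongr
            exact Set.iUnion₂_subset fun y _ => Set.inter_subset_right
    have hEsub : E ⊆ ⋃ i, ⋃ y ∈ S i, E ∩ Metric.ball (y : ℝ) (r y) := by
      intro x hx
      have := hSc ⟨⟨x, hx⟩, rfl⟩
      simp only [Set.mem_iUnion] at this ⊢
      obtain ⟨i, y, hy, h⟩ := this
      exact ⟨i, y, hy, hx, h⟩
    calc volume E ≤ ∑ i, volume (⋃ y ∈ S i, E ∩ Metric.ball (y : ℝ) (r y)) :=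
          (measure_mono hEsub).trans (measure_iUnion_fintype_le _ _)
      _ ≤ ∑ _i : Fin N, (nondivConst N k + 1) * κ * volume (Set.Icc a b) :=
          Finset.sum_le_sum fun i _ => hfam i
      _ = _ := by
          rw [Finset.sum_const, Finset.card_univ, Fintype.card_fin, nsmul_eq_mul]
          simp only [nondivConst, Nat.cast_mul, Nat.cast_add, Nat.cast_one]
          ring

/-- The `j × j` minors of a `j × k` matrix, for all maps choosing the columns. -/
def minors {j k : ℕ} (M : Matrix (Fin j) (Fin k) ℝ) : (Fin j → Fin k) → ℝ :=
  fun σ => (M.submatrix id σ).det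

section Minors

open Matrix

variable {j k : ℕ}

theorem minors_mul_left (A : Matrix (Fin j) (Fin j) ℝ) (M : Matrix (Fin j) (Fin k) ℝ) :
    minors (A * M) = A.det • minors M := by
  funext σ
  have : (A * M).submatrix id σ = A * M.submatrix id σ := by
    ext a c; simp [Matrix.mul_apply]
  simp [minors, this, Matrix.det_mul]

theorem det_mul_eq_sum_minors (M : Matrix (Fin j) (Fin k) ℝ) (B : Matrix (Fin k) (Fin j) ℝ) :
    (M * B).det = ∑ τ : Fin j → Fin k, (∏ i, B (τ i) i) * minors M τ := by
  rw [← Matrix.det_transpose]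
  have h : (M * B)ᵀ = fun i => ∑ c, B c i • Mᵀ c := by
    funext i a
    simp [Matrix.mul_apply, Finset.sum_apply, mul_comm]
  have h2 := (Matrix.detRowAlternating (n := Fin j) (R := ℝ)).toMultilinearMap.map_sum
    fun i c => B c i • Mᵀ c
  rw [h]
  refine h2.trans (Finset.sum_congr rfl fun τ _ => ?_)
  have h3 := (Matrix.detRowAlternating (n := Fin j) (R := ℝ)).toMultilinearMap.map_smul_univ
    (fun i => B (τ i) i) fun i => Mᵀ (τ i)
  refine h3.trans ?_
  rw [smul_eq_mul, minors, ← Matrix.det_transpose]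
  rfl

theorem minors_ne_zero {M : Matrix (Fin j) (Fin k) ℝ} (hM : LinearIndependent ℝ M.row) :
    minors M ≠ 0 := by
  intro h0
  obtain ⟨g, hg⟩ := M.vecMulLinear.exists_leftInverse_of_injective
    (LinearMap.ker_eq_bot.2 (Matrix.vecMul_injective_iff.2 hM))
  let B : Matrix (Fin k) (Fin j) ℝ := fun c => g (Pi.single c 1)
  have hB : M * B = 1 := by
    ext a i
    have h1 : g (Matrix.vecMul (Pi.single a 1) M) = Pi.single a 1 :=
      LinearMap.congr_fun hg (Pi.single a 1)
    rw [Matrix.single_one_vecMul] at h1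
    have h2 : M.row a = ∑ c, M a c • (Pi.single c (1 : ℝ) : Fin k → ℝ) := by
      rw [← pi_eq_sum_univ' (M a)]; rfl
    rw [h2, map_sum] at h1
    have h3 := congrFun h1 i
    simp only [map_smul, Finset.sum_apply, Pi.smul_apply, smul_eq_mul] at h3
    rw [Matrix.mul_apply, h3, Matrix.one_apply, Pi.single_apply]
    simp [eq_comm]
  have := det_mul_eq_sum_minors M B
  rw [hB, h0] at this
  simp at this

theorem norm_minors_mul_le (G : Matrix (Fin k) (Fin k) ℝ) :
    ∃ C : ℝ, 0 ≤ C ∧ ∀ M : Matrix (Fin j) (Fin k) ℝ, ‖minors (M * G)‖ ≤ C * ‖minors M‖ := by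
  refine ⟨∑ σ : Fin j → Fin k, ∑ τ : Fin j → Fin k, |∏ i, G (τ i) (σ i)|,
    Finset.sum_nonneg fun _ _ => Finset.sum_nonneg fun _ _ => abs_nonneg _, fun M => ?_⟩
  have hnn : 0 ≤ ‖minors M‖ := norm_nonneg _
  rw [pi_norm_le_iff_of_nonneg (by positivity)]
  intro σ
  have h1 : minors (M * G) σ = (M * G.submatrix id σ).det := by
    rw [minors]; congr 1
  rw [h1, det_mul_eq_sum_minors, Real.norm_eq_abs]
  calc |∑ τ : Fin j → Fin k, (∏ i, G.submatrix id σ (τ i) i) * minors M τ|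
      ≤ ∑ τ : Fin j → Fin k, |∏ i, G (τ i) (σ i)| * ‖minors M‖ := by
        refine (Finset.abs_sum_le_sum_abs _ _).trans (Finset.sum_le_sum fun τ _ => ?_)
        rw [abs_mul]
        exact mul_le_mul_of_nonneg_left (norm_le_pi_norm (minors M) τ) (abs_nonneg _)
    _ = (∑ τ : Fin j → Fin k, |∏ i, G (τ i) (σ i)|) * ‖minors M‖ := by rw [Finset.sum_mul]
    _ ≤ _ := by
        refine mul_le_mul_of_nonneg_right ?_ hnn
        exact Finset.single_le_sum (f := fun σ : Fin j → Fin k =>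
          ∑ τ : Fin j → Fin k, |∏ i, G (τ i) (σ i)|)
          (fun _ _ => Finset.sum_nonneg fun _ _ => abs_nonneg _) (Finset.mem_univ σ)

theorem minors_vecCons (v : Fin k → ℝ) (M : Matrix (Fin j) (Fin k) ℝ) (σ : Fin (j + 1) → Fin k) :
    minors (Matrix.of (vecCons v M)) σ =
      ∑ c : Fin (j + 1), (-1) ^ (c : ℕ) * v (σ c) * minors M (fun i => σ (c.succAbove i)) := by
  rw [minors, Matrix.det_succ_row_zero]
  rfl

theorem norm_minors_vecCons_le (v : Fin k → ℝ) (M : Matrix (Fin j) (Fin k) ℝ) :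
    ‖minors (Matrix.of (vecCons v M))‖ ≤ (j + 1) * ‖v‖ * ‖minors M‖ := by
  rw [pi_norm_le_iff_of_nonneg (by positivity)]
  intro σ
  rw [minors_vecCons, Real.norm_eq_abs]
  calc _ ≤ ∑ _c : Fin (j + 1), ‖v‖ * ‖minors M‖ := by
        refine (Finset.abs_sum_le_sum_abs _ _).trans (Finset.sum_le_sum fun c _ => ?_)
        rw [abs_mul, abs_mul, abs_pow, abs_neg, abs_one, one_pow, one_mul]
        exact mul_le_mul (norm_le_pi_norm v _) (norm_le_pi_norm (minors M) _) (abs_nonneg _)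
          (norm_nonneg _)
    _ = _ := by simp; ring

/-- Minkowski's theorem on linear forms, for a square matrix. -/
theorem exists_int_vecMul_norm_le [NeZero j] (A : Matrix (Fin j) (Fin j) ℝ) (hA : A.det ≠ 0)
    {r : ℝ} (hr : 0 ≤ r) (hrA : |A.det| ≤ r ^ j) :
    ∃ m : Fin j → ℤ, m ≠ 0 ∧ ‖(fun i => (m i : ℝ)) ᵥ* A‖ ≤ r := by
  let b := Pi.basisFun ℝ (Fin j)
  let L : AddSubgroup (Fin j → ℝ) := (Submodule.span ℤ (Set.range b)).toAddSubgroup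
  have : Countable L := inferInstanceAs (Countable (Submodule.span ℤ (Set.range b)))
  have : DiscreteTopology L :=
    inferInstanceAs (DiscreteTopology (Submodule.span ℤ (Set.range b)))
  have hdet : LinearMap.det A.vecMulLinear ≠ 0 := by
    have : A.vecMulLinear = Matrix.toLin' Aᵀ := by
      ext; simp
    rw [this, LinearMap.det_toLin', Matrix.det_transpose]; exact hA
  have hdet' : LinearMap.det A.vecMulLinear = A.det := by
    have : A.vecMulLinear = Matrix.toLin' Aᵀ := by
      ext; simp
    rw [this, LinearMap.det_toLin', Matrix.det_transpose]
  have hcont : Continuous A.vecMulLinear := LinearMap.continuous_of_finiteDimensional _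
  have hcpt : IsCompact (A.vecMulLinear ⁻¹' Metric.closedBall 0 r) := by
    have := ((A.vecMulLinear.equivOfDetNeZero hdet).toContinuousLinearEquiv.toHomeomorph
      ).isCompact_preimage.2 (isCompact_closedBall (0 : Fin j → ℝ) r)
    exact this
  obtain ⟨⟨x, hx⟩, hx0, hxs⟩ := exists_ne_zero_mem_lattice_of_measure_mul_two_pow_le_measure
    (μ := volume) (L := L) (s := A.vecMulLinear ⁻¹' Metric.closedBall 0 r)
    (ZSpan.isAddFundamentalDomain' b volume)
    (fun x hx => by simpa using hx)
    ((convex_closedBall (0 : Fin j → ℝ) r).linear_preimage _)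
    hcpt (by
      rw [Measure.addHaar_preimage_linearMap volume hdet, hdet', ZSpan.volume_fundamentalDomain]
      have : (Matrix.of b).det = 1 := by
        have : Matrix.of b = (1 : Matrix (Fin j) (Fin j) ℝ) := by
          ext a c; simp [b, Matrix.one_apply, Pi.single_apply, eq_comm]
        rw [this, Matrix.det_one]
      rw [this, Real.volume_pi_closedBall _ hr, Module.finrank_fin_fun, Fintype.card_fin,
        abs_one, ENNReal.ofReal_one, one_mul, abs_inv,
        ← ENNReal.ofReal_mul (by positivity), mul_pow]
      have h2 : (2 : ENNReal) ^ j = ENNReal.ofReal (2 ^ j) := by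
        rw [ENNReal.ofReal_pow (by norm_num)]; norm_num
      rw [h2]
      apply ENNReal.ofReal_le_ofReal
      have hpos : 0 < |A.det| := abs_pos.2 hA
      rw [inv_mul_eq_div, le_div_iff₀ hpos]
      gcongr)
  have hx' : x ∈ Submodule.span ℤ (Set.range b) := hx
  rw [Module.Basis.mem_span_iff_repr_mem] at hx'
  choose m hm using hx'
  have hxm : x = fun i => (m i : ℝ) := by
    funext i
    have := hm i
    simpa [b] using this.symm
  refine ⟨m, ?_, ?_⟩
  · rintro rfl
    apply hx0
    ext i
    simp [hxm]
  · rw [← hxm]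
    simpa using hxs

/-- A lower bound for the lengths of integer combinations of the rows bounds the minors below. -/
theorem pow_le_norm_minors {M : Matrix (Fin j) (Fin k) ℝ} (hM : LinearIndependent ℝ M.row)
    {δ : ℝ} (hδ : 0 ≤ δ)
    (h : ∀ m : Fin j → ℤ, m ≠ 0 → δ ≤ ‖(fun i => (m i : ℝ)) ᵥ* M‖) :
    δ ^ j ≤ (j : ℝ) ^ j * ‖minors M‖ := by
  have hne := minors_ne_zero hM
  obtain ⟨σ₀, hσ₀⟩ := Function.ne_iff.1 hne
  have : Nonempty (Fin j → Fin k) := ⟨σ₀⟩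
  obtain ⟨σ, hσ⟩ := Finite.exists_max (fun σ => |minors M σ|)
  set D := minors M σ with hD
  have hD0 : D ≠ 0 := by
    intro h0
    have := hσ σ₀
    rw [h0, abs_zero] at this
    exact hσ₀ (abs_nonpos_iff.1 this)
  have hDle : |D| ≤ ‖minors M‖ := norm_le_pi_norm (minors M) σ
  rcases Nat.eq_zero_or_pos j with rfl | hj
  · have h1 : minors M σ = 1 := by simp [minors]
    rw [hD, h1] at hDle
    simpa using hDle
  have : NeZero j := ⟨hj.ne'⟩
  set A := M.submatrix id σ with hA
  have hAD : A.det = D := rfl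
  have hAu : IsUnit A.det := by rw [hAD]; exact isUnit_iff_ne_zero.2 hD0
  set r := |D| ^ ((j : ℝ)⁻¹) with hr
  have hrj : r ^ j = |D| := Real.rpow_inv_natCast_pow (abs_nonneg _) hj.ne'
  have hr0 : 0 ≤ r := by positivity
  obtain ⟨m, hm0, hm⟩ := exists_int_vecMul_norm_le A (by rw [hAD]; exact hD0) hr0
    (by rw [hrj, hAD])
  set T := A⁻¹ * M with hT
  have hAT : A * T = M := by rw [hT, ← Matrix.mul_assoc, Matrix.mul_nonsing_inv _ hAu, Matrix.one_mul]
  have hTle : ∀ a c, |T a c| ≤ 1 := by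
    intro a c
    have h1 : A *ᵥ (fun i => T i c) = fun i => M i c := by
      funext i
      rw [← hAT]; rfl
    have h2 : A.det * T a c = minors M (Function.update σ a c) := by
      have h3 : (A.cramer fun i => M i c) a = A.det * T a c := by
        rw [← h1, Matrix.cramer_eq_adjugate_mulVec, Matrix.mulVec_mulVec, Matrix.adjugate_mul,
          Matrix.smul_mulVec, Matrix.one_mulVec]
        rfl
      rw [← h3, Matrix.cramer_apply, minors]
      congr 1
      ext i l
      by_cases hl : l = a
      · subst hl; simp
      · simp [hl, hA]
    have h4 := hσ (Function.update σ a c)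
    rw [← h2, abs_mul, hAD] at h4
    exact le_of_mul_le_mul_left (by linarith) (abs_pos.2 hD0)
  have hle : δ ≤ j * r := by
    refine (h m hm0).trans ?_
    rw [← hAT, ← Matrix.vecMul_vecMul, pi_norm_le_iff_of_nonneg (by positivity)]
    intro c
    rw [Matrix.vecMul, dotProduct, Real.norm_eq_abs]
    refine (Finset.abs_sum_le_sum_abs _ _).trans ?_
    calc _ ≤ ∑ _i : Fin j, r := Finset.sum_le_sum fun i _ => by
            rw [abs_mul]
            have h5 := (norm_le_pi_norm _ i).trans hm
            rw [Real.norm_eq_abs] at h5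
            exact (mul_le_mul h5 (hTle i c) (abs_nonneg _) hr0).trans (by rw [mul_one])
      _ = j * r := by simp
  calc δ ^ j ≤ (j * r) ^ j := pow_le_pow_left₀ hδ hle _
    _ = (j : ℝ) ^ j * |D| := by rw [mul_pow, hrj]
    _ ≤ _ := by gcongr

end Minors

/-- The real matrix whose rows are the given integer vectors. -/
def intRows {j k : ℕ} (b : Fin j → Fin k → ℤ) : Matrix (Fin j) (Fin k) ℝ :=
  Matrix.of fun a c => (b a c : ℝ)

/-- `b` is a linearly independent family of integer vectors spanning `V`. -/
def IsIntBasis {j k : ℕ} (V : Submodule ℝ (Fin k → ℝ)) (b : Fin j → Fin k → ℤ) : Prop :=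
  LinearIndependent ℝ (intRows b).row ∧ Submodule.span ℝ (Set.range (intRows b).row) = V

section Height

open Matrix

variable {k : ℕ}

theorem IsIntBasis.finrank_eq {V : Submodule ℝ (Fin k → ℝ)} {j : ℕ} {b : Fin j → Fin k → ℤ}
    (hb : IsIntBasis V b) : Module.finrank ℝ V = j := by
  rw [← hb.2, finrank_span_eq_card hb.1, Fintype.card_fin]

theorem IsIntBasis.le_dim {V : Submodule ℝ (Fin k → ℝ)} {j : ℕ} {b : Fin j → Fin k → ℤ}
    (hb : IsIntBasis V b) : j ≤ k := by
  have := hb.1.fintype_card_le_finrank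
  simpa using this

theorem IsIntBasis.exists_mul {V : Submodule ℝ (Fin k → ℝ)} {j : ℕ} {b b' : Fin j → Fin k → ℤ}
    (hb : IsIntBasis V b) (hb' : IsIntBasis V b') :
    ∃ A : Matrix (Fin j) (Fin j) ℝ, intRows b' = A * intRows b := by
  have : ∀ a, ∃ c : Fin j → ℝ, ∑ i, c i • (intRows b).row i = (intRows b').row a := by
    intro a
    rw [← Submodule.mem_span_range_iff_exists_fun, hb.2, ← hb'.2]
    exact Submodule.subset_span ⟨a, rfl⟩
  choose A hA using this
  refine ⟨Matrix.of A, ?_⟩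
  ext a c
  have := congrFun (hA a) c
  rw [Matrix.mul_apply]
  simpa [Finset.sum_apply] using this.symm

theorem minors_intRows {j : ℕ} (b : Fin j → Fin k → ℤ) (σ : Fin j → Fin k) :
    minors (intRows b) σ = ((Matrix.of fun a c => b a (σ c)).det : ℤ) := by
  have h : (intRows b).submatrix id σ = (Matrix.of fun a c => b a (σ c)).map (Int.castRingHom ℝ) := by
    ext; simp [intRows]
  rw [minors, h, ← RingHom.mapMatrix_apply, ← RingHom.map_det]
  rfl

/-- Among the integer bases of a subspace there is one minimizing the norms of the minors after
every linear change of variables. -/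
theorem exists_minimal_intBasis {V : Submodule ℝ (Fin k → ℝ)}
    (hV : ∃ (j : ℕ) (b : Fin j → Fin k → ℤ), IsIntBasis V b) :
    ∃ (j : ℕ) (b : Fin j → Fin k → ℤ), IsIntBasis V b ∧
      ∀ (j' : ℕ) (b' : Fin j' → Fin k → ℤ), IsIntBasis V b' →
        ∀ G : Matrix (Fin k) (Fin k) ℝ,
          ‖minors (intRows b * G)‖ ≤ ‖minors (intRows b' * G)‖ := by
  classical
  obtain ⟨j, b₀, hb₀⟩ := hV
  let F : (Fin j → Fin k → ℤ) → ℕ :=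
    fun b => ∑ σ : Fin j → Fin k, ((Matrix.of fun a c => b a (σ c)).det : ℤ).natAbs
  have hF : ∀ b, (F b : ℝ) = ∑ σ : Fin j → Fin k, |minors (intRows b) σ| := by
    intro b
    simp only [F, minors_intRows, Nat.cast_sum, Nat.cast_natAbs, Int.cast_abs]
  have hex : ∃ n, ∃ b, IsIntBasis V b ∧ F b = n := ⟨_, b₀, hb₀, rfl⟩
  obtain ⟨b, hb, hbn⟩ := Nat.find_spec hex
  refine ⟨j, b, hb, fun j' b' hb' G => ?_⟩
  obtain rfl : j' = j := by rw [← hb.finrank_eq, hb'.finrank_eq]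
  have hmin : F b ≤ F b' := by
    rw [hbn]
    exact Nat.find_min' hex ⟨b', hb', rfl⟩
  obtain ⟨A, hA⟩ := hb.exists_mul hb'
  have hFA : (F b' : ℝ) = |A.det| * F b := by
    rw [hF, hF, hA, minors_mul_left, Finset.mul_sum]
    simp [abs_mul]
  have hpos : 0 < (F b : ℝ) := by
    rw [hF]
    obtain ⟨σ, hσ⟩ := Function.ne_iff.1 (minors_ne_zero hb.1)
    exact Finset.sum_pos' (fun _ _ => abs_nonneg _) ⟨σ, Finset.mem_univ _, abs_pos.2 hσ⟩
  have hdet : 1 ≤ |A.det| := by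
    have h1 : (F b : ℝ) ≤ F b' := by exact_mod_cast hmin
    rw [hFA] at h1
    nlinarith
  rw [hA, Matrix.mul_assoc, minors_mul_left, norm_smul, Real.norm_eq_abs]
  exact le_mul_of_one_le_left (norm_nonneg _) hdet

/-- Subspaces of `ℝ^k` spanned by integer vectors. -/
def RatSubspace (k : ℕ) : Type :=
  {V : Submodule ℝ (Fin k → ℝ) // ∃ (j : ℕ) (b : Fin j → Fin k → ℤ), IsIntBasis V b}

noncomputable instance : PartialOrder (RatSubspace k) :=
  inferInstanceAs (PartialOrder
    {V : Submodule ℝ (Fin k → ℝ) // ∃ (j : ℕ) (b : Fin j → Fin k → ℤ), IsIntBasis V b})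

/-- The dimension of a rational subspace. -/
noncomputable def RatSubspace.rank (V : RatSubspace k) : ℕ :=
  (exists_minimal_intBasis V.2).choose

/-- An integer basis of a rational subspace with minimal minors. -/
noncomputable def RatSubspace.basis (V : RatSubspace k) : Fin V.rank → Fin k → ℤ :=
  (exists_minimal_intBasis V.2).choose_spec.choose

theorem RatSubspace.isIntBasis (V : RatSubspace k) : IsIntBasis V.1 V.basis :=
  (exists_minimal_intBasis V.2).choose_spec.choose_spec.1

/-- The height of a rational subspace after the linear change of variables `v ↦ v G`. -/
noncomputable def RatSubspace.height (V : RatSubspace k) (G : Matrix (Fin k) (Fin k) ℝ) : ℝ :=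
  ‖minors (intRows V.basis * G)‖

theorem RatSubspace.height_le (V : RatSubspace k) {j : ℕ} {b : Fin j → Fin k → ℤ}
    (hb : IsIntBasis V.1 b) (G : Matrix (Fin k) (Fin k) ℝ) :
    V.height G ≤ ‖minors (intRows b * G)‖ :=
  (exists_minimal_intBasis V.2).choose_spec.choose_spec.2 j b hb G

theorem RatSubspace.card_le_of_isChain {F : Finset (RatSubspace k)}
    (hF : IsChain (· ≤ ·) (F : Set (RatSubspace k))) (h0 : ∀ V ∈ F, V.1 ≠ ⊥) : F.card ≤ k := by
  classical
  have hinj : Set.InjOn (fun V : RatSubspace k => Module.finrank ℝ V.1) F := by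
    intro V hV W hW hVW
    rcases hF.total hV hW with h | h
    · exact Subtype.ext (Submodule.eq_of_le_of_finrank_eq h hVW)
    · exact Subtype.ext (Submodule.eq_of_le_of_finrank_eq h hVW.symm).symm
  have hmaps : Set.MapsTo (fun V : RatSubspace k => Module.finrank ℝ V.1) F (Finset.Icc 1 k) := by
    intro V hV
    rw [Finset.mem_coe, Finset.mem_Icc]
    refine ⟨Nat.one_le_iff_ne_zero.2 fun h => h0 V hV (Submodule.finrank_eq_zero.1 h), ?_⟩
    have := Submodule.finrank_le V.1
    simpa using this
  have := Finset.card_le_card_of_injOn _ hmaps hinj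
  simpa using this

theorem intRows_vecCons_mul {j : ℕ} (v : Fin k → ℤ) (b : Fin j → Fin k → ℤ)
    (G : Matrix (Fin k) (Fin k) ℝ) :
    intRows (vecCons v b : Fin (j + 1) → Fin k → ℤ) * G =
      Matrix.of (vecCons ((fun i => (v i : ℝ)) ᵥ* G) (intRows b * G)) := by
  ext a c
  refine Fin.cases ?_ (fun a => ?_) a
  · simp [intRows, Matrix.mul_apply, Matrix.vecMul, dotProduct]
  · rfl

theorem row_intRows_vecCons {j : ℕ} (v : Fin k → ℤ) (b : Fin j → Fin k → ℤ) :
    (intRows (vecCons v b : Fin (j + 1) → Fin k → ℤ)).row =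
      (Fin.cons (fun i => (v i : ℝ)) (intRows b).row : Fin (j + 1) → Fin k → ℝ) := by
  funext a
  refine Fin.cases ?_ (fun a => ?_) a
  · rfl
  · rfl

theorem mem_span_iff_minors_vecCons {j : ℕ} {M : Matrix (Fin j) (Fin k) ℝ}
    (hM : LinearIndependent ℝ M.row) (v : Fin k → ℝ) :
    v ∈ Submodule.span ℝ (Set.range M.row) ↔ minors (Matrix.of (vecCons v M)) = 0 := by
  constructor
  · intro hv
    obtain ⟨c, hc⟩ := (Submodule.mem_span_range_iff_exists_fun ℝ).1 hv
    funext σ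
    refine Matrix.exists_vecMul_eq_zero_iff.1 ⟨vecCons (-1) c, ?_, ?_⟩
    · intro h
      have := congrFun h 0
      simp at this
    · funext i
      have := congrFun hc (σ i)
      simp only [Finset.sum_apply, Pi.smul_apply, smul_eq_mul] at this
      rw [Matrix.vecMul, dotProduct, Fin.sum_univ_succ]
      change -1 * v (σ i) + ∑ l, c l * M l (σ i) = 0
      rw [← this]
      simp [Matrix.row]
  · intro h0
    by_contra hv
    have hli : LinearIndependent ℝ (Matrix.of (vecCons v M)).row := by
      have : (Matrix.of (vecCons v M)).row = (Fin.cons v M.row : Fin (j + 1) → Fin k → ℝ) := rfl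
      rw [this, linearIndependent_finCons]
      exact ⟨hM, hv⟩
    exact minors_ne_zero hli h0

theorem RatSubspace.finite_height_lt {G : Matrix (Fin k) (Fin k) ℝ} (hG : IsUnit G.det) (ρ : ℝ) :
    {V : RatSubspace k | V.height G < ρ}.Finite := by
  have hC : ∀ j : ℕ, ∃ C : ℝ, 0 ≤ C ∧ ∀ M : Matrix (Fin j) (Fin k) ℝ,
      ‖minors (M * G⁻¹)‖ ≤ C * ‖minors M‖ := fun j => norm_minors_mul_le G⁻¹
  choose C hC0 hC using hC
  let P : (j : ℕ) → ((Fin j → Fin k) → ℤ) → Set (Fin k → ℝ) := fun j z =>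
    {v | ∀ σ : (Fin (j + 1) → Fin k), ∑ c : Fin (j + 1),
      (-1) ^ (c : ℕ) * v (σ c) * ((z (fun i => σ (c.succAbove i)) : ℤ) : ℝ) = 0}
  let Z : (j : ℕ) → Set ((Fin j → Fin k) → ℤ) := fun j =>
    Set.Icc (fun _ => -⌈C j * ρ⌉) (fun _ => ⌈C j * ρ⌉)
  have hfin : (⋃ j ∈ Finset.range (k + 1), P j '' Z j).Finite :=
    Set.Finite.biUnion (Finset.finite_toSet _) fun j _ => (Set.finite_Icc _ _).image _
  refine (hfin.preimage (f := fun V : RatSubspace k => (V.1 : Set (Fin k → ℝ))) ?_).subset ?_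
  · exact fun V _ W _ h => Subtype.ext (SetLike.coe_injective h)
  · intro V hV
    have hb := V.isIntBasis
    simp only [Set.mem_preimage, Set.mem_iUnion]
    refine ⟨V.rank, Finset.mem_range.2 (Nat.lt_succ_of_le hb.le_dim),
      fun σ => (Matrix.of fun a c => V.basis a (σ c)).det, ?_, ?_⟩
    · have hle : ‖minors (intRows V.basis)‖ ≤ C V.rank * ρ := by
        have h1 := hC V.rank (intRows V.basis * G)
        rw [Matrix.mul_assoc, Matrix.mul_nonsing_inv _ hG, Matrix.mul_one] at h1
        exact h1.trans (mul_le_mul_of_nonneg_left (le_of_lt hV) (hC0 _))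
      have habs : ∀ σ : Fin V.rank → Fin k, |(Matrix.of fun a c => V.basis a (σ c)).det| ≤ ⌈C V.rank * ρ⌉ := by
        intro σ
        have h2 := (norm_le_pi_norm (minors (intRows V.basis)) σ).trans hle
        rw [minors_intRows, Real.norm_eq_abs] at h2
        have h3 := h2.trans (Int.le_ceil _)
        exact_mod_cast h3
      exact ⟨fun σ => (abs_le.1 (habs σ)).1, fun σ => (abs_le.1 (habs σ)).2⟩
    · ext v
      have h1 := mem_span_iff_minors_vecCons hb.1 v
      rw [hb.2] at h1
      rw [SetLike.mem_coe, h1]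
      simp only [P, Set.mem_ofPred_eq, funext_iff, Pi.zero_apply]
      refine forall_congr' fun σ => ?_
      rw [minors_vecCons]
      simp only [minors_intRows]

theorem intCast_vecMul_intRows {j : ℕ} (m : Fin j → ℤ) (b : Fin j → Fin k → ℤ) :
    (fun i => (m i : ℝ)) ᵥ* intRows b = fun i => ((∑ a, m a * b a i : ℤ) : ℝ) := by
  funext i
  simp [Matrix.vecMul, dotProduct, intRows]

theorem RatSubspace.le_height {G : Matrix (Fin k) (Fin k) ℝ} (hG : IsUnit G.det) {δ : ℝ}
    (hδ : 0 ≤ δ) (hδ1 : δ ≤ 1)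
    (h : ∀ v : Fin k → ℤ, v ≠ 0 → δ ≤ ‖(fun i => (v i : ℝ)) ᵥ* G‖) (V : RatSubspace k) :
    δ ^ k ≤ (k : ℝ) ^ k * V.height G := by
  have hb := V.isIntBasis
  have hinj : Function.Injective fun x : Fin V.rank → ℝ => x ᵥ* intRows V.basis :=
    Matrix.vecMul_injective_iff.2 hb.1
  have hGinj : Function.Injective fun x : Fin k → ℝ => x ᵥ* G :=
    Matrix.vecMul_injective_iff_isUnit.2 ((Matrix.isUnit_iff_isUnit_det _).2 hG)
  have hli : LinearIndependent ℝ (intRows V.basis * G).row := by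
    rw [← Matrix.vecMul_injective_iff]
    intro x y hxy
    simp only [← Matrix.vecMul_vecMul] at hxy
    exact hinj (hGinj hxy)
  have h1 := pow_le_norm_minors hli hδ ?_
  · have hj : V.rank ≤ k := hb.le_dim
    have h2 : (V.rank : ℝ) ^ V.rank ≤ (k : ℝ) ^ k := by
      have : V.rank ^ V.rank ≤ k ^ k := by
        rcases Nat.eq_zero_or_pos k with h0 | h0
        · have : V.rank = 0 := by omega
          rw [this, h0]
        · exact (Nat.pow_le_pow_left hj _).trans (Nat.pow_le_pow_right h0 hj)
      exact_mod_cast this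
    calc δ ^ k ≤ δ ^ V.rank := pow_le_pow_of_le_one hδ hδ1 hj
      _ ≤ (V.rank : ℝ) ^ V.rank * V.height G := h1
      _ ≤ _ := mul_le_mul_of_nonneg_right h2 (norm_nonneg _)
  · intro m hm
    rw [← Matrix.vecMul_vecMul, intCast_vecMul_intRows]
    apply h
    intro h0
    apply hm
    have h3 : (fun i => (m i : ℝ)) ᵥ* intRows V.basis = 0 ᵥ* intRows V.basis := by
      rw [intCast_vecMul_intRows, Matrix.zero_vecMul]
      funext i
      have := congrFun h0 i
      simp only [Pi.zero_apply] at this ⊢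
      rw [this, Int.cast_zero]
    have h4 := hinj h3
    funext i
    have := congrFun h4 i
    simpa using this

theorem le_norm_vecMul_of_marked {G : ℝ → Matrix (Fin k) (Fin k) ℝ} {ρ ε x : ℝ} (hερ : ε ≤ ρ)
    (hρ : ρ ≤ 1)
    (hx : Marked (fun (V : RatSubspace k) y => V.height (G y)) ρ ε {V | V.1 ≠ ⊥} x)
    {v : Fin k → ℤ} (hv : v ≠ 0) :
    ε ≤ k * ‖(fun i => (v i : ℝ)) ᵥ* G x‖ := by
  classical
  obtain ⟨F, hFT, hFc, hval, hout⟩ := hx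
  set w : Fin k → ℝ := fun i => (v i : ℝ) with hw
  have hw0 : w ≠ 0 := by
    obtain ⟨i, hi⟩ := Function.ne_iff.1 hv
    refine Function.ne_iff.2 ⟨i, ?_⟩
    simpa [hw] using hi
  have hW : ∃ W : RatSubspace k, w ∉ W.1 ∧ W.height (G x) ≤ 1 ∧ (∀ r ∈ F, w ∈ r.1 → W ≤ r) ∧
      ∀ r ∈ F, w ∉ r.1 → r ≤ W := by
    by_cases hne : (F.filter fun r => w ∉ r.1).Nonempty
    · obtain ⟨W, hW⟩ := Finset.exists_maximal hne
      have hWF := Finset.mem_filter.1 hW.prop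
      refine ⟨W, hWF.2, (hval W hWF.1).2.le.trans hρ, fun r hr hwr => ?_, fun r hr hwr => ?_⟩
      · rcases hFc.total hWF.1 hr with h | h
        · exact h
        · exact absurd (h hwr) hWF.2
      · rcases hFc.total hWF.1 hr with h | h
        · exact hW.le_of_ge (Finset.mem_filter.2 ⟨hr, hwr⟩) h
        · exact h
    · have hbot : IsIntBasis (⊥ : Submodule ℝ (Fin k → ℝ)) (Fin.elim0 : Fin 0 → Fin k → ℤ) := by
        refine ⟨linearIndependent_empty_type, ?_⟩
        rw [Set.range_eq_empty, Submodule.span_empty]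
      refine ⟨⟨⊥, 0, _, hbot⟩, by simpa using hw0, ?_, fun r _ _ => bot_le (a := r.1), ?_⟩
      · refine (RatSubspace.height_le ⟨⊥, 0, _, hbot⟩ hbot _).trans ?_
        rw [pi_norm_le_iff_of_nonneg zero_le_one]
        intro σ
        simp [minors]
      · intro r hr hwr
        exact absurd ⟨r, Finset.mem_filter.2 ⟨hr, hwr⟩⟩ hne
  obtain ⟨W, hwW, hW1, hWle, hleW⟩ := hW
  have hb := W.isIntBasis
  let b' : Fin (W.rank + 1) → Fin k → ℤ := vecCons v W.basis
  have hli : LinearIndependent ℝ (intRows b').row := by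
    rw [row_intRows_vecCons, linearIndependent_finCons, hb.2]
    exact ⟨hb.1, hwW⟩
  let V' : RatSubspace k := ⟨_, _, b', hli, rfl⟩
  have hV' : V'.1 = Submodule.span ℝ {w} ⊔ W.1 := by
    change Submodule.span ℝ (Set.range (intRows b').row) = _
    rw [row_intRows_vecCons, Fin.range_cons, Set.insert_eq, Submodule.span_union, hb.2]
  have hwV' : w ∈ V'.1 := by
    rw [hV']; exact Submodule.mem_sup_left (Submodule.mem_span_singleton_self w)
  have hWV' : W.1 ≤ V'.1 := by rw [hV']; exact le_sup_right
  have hV'0 : V'.1 ≠ ⊥ := fun h => hw0 (by rw [h] at hwV'; simpa using hwV')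
  have hle : ε ≤ V'.height (G x) := by
    by_cases hF : V' ∈ F
    · exact (hval V' hF).1
    · refine hερ.trans (hout V' hV'0 hF fun r hr => ?_)
      by_cases hwr : w ∈ r.1
      · left
        change V'.1 ≤ r.1
        rw [hV']
        exact sup_le ((Submodule.span_singleton_le_iff_mem _ _).2 hwr) (hWle r hr hwr)
      · right
        exact le_trans (hleW r hr hwr) hWV'
  refine hle.trans ((V'.height_le ⟨hli, rfl⟩ (G x)).trans ?_)
  rw [intRows_vecCons_mul]
  refine (norm_minors_vecCons_le _ _).trans ?_
  have hcard : ((W.rank : ℝ) + 1) ≤ k := by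
    have := IsIntBasis.le_dim (V := V'.1) ⟨hli, rfl⟩
    exact_mod_cast this
  calc _ ≤ ((W.rank : ℝ) + 1) * ‖w ᵥ* G x‖ * 1 :=
        mul_le_mul_of_nonneg_left hW1 (by positivity)
    _ ≤ _ := by
        rw [mul_one]
        exact mul_le_mul_of_nonneg_right hcard (norm_nonneg _)

end Height

theorem exists_zero_of_zeros {a b : ℝ} : ∀ (m : ℕ) (D : ℕ → ℝ → ℝ),
    (∀ k, ∀ x ∈ Set.Icc a b, HasDerivAt (D k) (D (k + 1) x) x) →
    ∀ s : Finset ℝ, s.card = m + 1 → (∀ x ∈ s, x ∈ Set.Icc a b ∧ D 0 x = 0) →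
    ∃ ξ ∈ Set.Icc a b, D m ξ = 0 := by
  intro m
  induction m with
  | zero =>
    intro D _ s hs hz
    obtain ⟨x, rfl⟩ := Finset.card_eq_one.1 hs
    exact ⟨x, hz x (Finset.mem_singleton_self x)⟩
  | succ m ih =>
    intro D hD s hs hz
    let e := s.orderEmbOfFin hs
    have he : ∀ i, e i ∈ s := fun i => s.orderEmbOfFin_mem hs i
    have key : ∀ i : Fin (m + 1), ∃ ξ ∈ Set.Ioo (e i.castSucc) (e i.succ), D 1 ξ = 0 := by
      intro i
      have hlt : e i.castSucc < e i.succ := e.strictMono i.castSucc_lt_succ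
      have hsub : Set.Icc (e i.castSucc) (e i.succ) ⊆ Set.Icc a b :=
        Set.Icc_subset_Icc (hz _ (he _)).1.1 (hz _ (he _)).1.2
      exact exists_hasDerivAt_eq_zero hlt
        (fun x hx => (hD 0 x (hsub hx)).continuousAt.continuousWithinAt)
        ((hz _ (he _)).2.trans (hz _ (he _)).2.symm)
        fun x hx => hD 0 x (hsub (Set.Ioo_subset_Icc_self hx))
    choose ξ hξ hξ0 using key
    have hmono : StrictMono ξ := by
      intro i j hij
      have h1 : i.succ ≤ j.castSucc := by
        rw [Fin.le_def]
        simpa using hij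
      exact (hξ i).2.trans_le ((e.monotone h1).trans (hξ j).1.le)
    refine ih (fun k => D (k + 1)) (fun k => hD (k + 1)) (Finset.univ.image ξ) ?_ ?_
    · rw [Finset.card_image_of_injective _ hmono.injective, Finset.card_univ, Fintype.card_fin]
    · intro x hx
      obtain ⟨i, -, rfl⟩ := Finset.mem_image.1 hx
      exact ⟨⟨(hz _ (he _)).1.1.trans (hξ i).1.le, (hξ i).2.le.trans (hz _ (he _)).1.2⟩, hξ0 i⟩

open Polynomial in
theorem exists_deriv_eq_divided_difference {a b : ℝ} {m : ℕ} {D : ℕ → ℝ → ℝ}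
    (hD : ∀ k, ∀ x ∈ Set.Icc a b, HasDerivAt (D k) (D (k + 1) x) x)
    {s : Finset ℝ} (hs : s.card = m + 1) (hsub : ∀ x ∈ s, x ∈ Set.Icc a b) :
    ∃ ξ ∈ Set.Icc a b, D m ξ =
      m.factorial * ∑ i ∈ s, D 0 i / ∏ j ∈ s.erase i, (i - j) := by
  have hinj : Set.InjOn (id : ℝ → ℝ) s := Set.injOn_id _
  set P : ℝ[X] := Lagrange.interpolate s id (D 0) with hP
  have hnode : ∀ i ∈ s, P.eval i = D 0 i := fun i hi =>
    Lagrange.eval_interpolate_at_node (D 0) hinj hi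
  obtain ⟨ξ, hξ, h0⟩ := exists_zero_of_zeros m
    (fun k x => D k x - (derivative^[k] P).eval x)
    (fun k x hx => (hD k x hx).sub (by
      rw [Function.iterate_succ_apply']
      exact (derivative^[k] P).hasDerivAt x)) s hs
    (fun x hx => ⟨hsub x hx, by simp [hnode x hx]⟩)
  refine ⟨ξ, hξ, ?_⟩
  have h1 := Lagrange.eval_iterate_derivative_eq_sum hinj
    (Lagrange.degree_interpolate_lt (D 0) hinj) (k := m) (by omega) ξ
  rw [← hP] at h1
  rw [sub_eq_zero.1 h0, h1]
  congr 1
  refine Finset.sum_congr rfl fun i hi => ?_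
  rw [hs, Nat.sub_self, Finset.powersetCard_zero]
  simp [hnode i hi]

theorem exists_separated_of_lt_volume {E : Set ℝ} {σ : ℝ} (hσ : 0 < σ) : ∀ m : ℕ,
    ENNReal.ofReal (2 * m * σ) < volume E →
    ∃ s : Finset ℝ, s.card = m + 1 ∧ (∀ x ∈ s, x ∈ E) ∧
      ∀ x ∈ s, ∀ y ∈ s, x ≠ y → σ ≤ |x - y| := by
  intro m
  induction m with
  | zero =>
    intro h
    have : E.Nonempty := by
      by_contra hE
      rw [Set.not_nonempty_iff_eq_empty.1 hE] at h
      simp at h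
    obtain ⟨x, hx⟩ := this
    refine ⟨{x}, rfl, by simpa using hx, ?_⟩
    intro y hy z hz hyz
    rw [Finset.mem_singleton] at hy hz
    exact absurd (hy.trans hz.symm) hyz
  | succ m ih =>
    intro h
    obtain ⟨s, hs, hsE, hsep⟩ := ih (lt_of_le_of_lt (ENNReal.ofReal_le_ofReal (by
      push_cast; nlinarith)) h)
    have hne : ¬ E ⊆ ⋃ x ∈ s, Metric.ball x σ := by
      intro hsub
      refine absurd ((measure_mono (μ := volume) hsub).trans (measure_biUnion_finset_le s _)) (not_le.2 ?_)
      simp only [Real.volume_ball, Finset.sum_const, hs, nsmul_eq_mul]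
      rw [← ENNReal.ofReal_natCast, ← ENNReal.ofReal_mul (Nat.cast_nonneg _)]
      convert h using 2
      ring
    obtain ⟨x, hxE, hx⟩ := Set.not_subset.1 hne
    simp only [Set.mem_iUnion, Metric.mem_ball, not_exists, not_lt, Real.dist_eq] at hx
    have hxs : x ∉ s := fun h => by
      have := hx x h
      simp at this
      linarith
    refine ⟨insert x s, by rw [Finset.card_insert_of_notMem hxs, hs], ?_, ?_⟩
    · intro y hy
      rcases Finset.mem_insert.1 hy with rfl | hy
      · exact hxE
      · exact hsE y hy
    · intro y hy z hz hyz
      rcases Finset.mem_insert.1 hy with hy' | hy' <;>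
        rcases Finset.mem_insert.1 hz with hz' | hz'
      · exact absurd (hy'.trans hz'.symm) hyz
      · rw [hy']; exact hx z hz'
      · rw [hz', abs_sub_comm]; exact hx y hy'
      · exact hsep y hy' z hz' hyz

/-- If the `m`-th derivative of a function is comparable to a constant on an interval, the function
is `(C, 1/m)`-good there. -/
theorem abs_mul_volume_pow_le {a b A ε : ℝ} {m : ℕ} (hm : m ≠ 0) {D : ℕ → ℝ → ℝ}
    (hD : ∀ k, ∀ x ∈ Set.Icc a b, HasDerivAt (D k) (D (k + 1) x) x)
    (hA : ∀ x ∈ Set.Icc a b, A ≤ |D m x|) (hA' : ∀ x ∈ Set.Icc a b, |D m x| ≤ 3 * A)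
    (hε : 0 < ε) {x : ℝ} (hx : x ∈ Set.Icc a b) :
    |D 0 x| * volume.real {y ∈ Set.Icc a b | |D 0 y| < ε} ^ m ≤
      (3 * (m + 1).factorial + m + 1) * (2 * m + 1) ^ m * ε * (b - a) ^ m := by
  classical
  set E := {y ∈ Set.Icc a b | |D 0 y| < ε} with hE
  set B := b - a with hB
  have hab : a ≤ b := hx.1.trans hx.2
  have hB0 : 0 ≤ B := sub_nonneg.2 hab
  have hEsub : E ⊆ Set.Icc a b := fun y hy => hy.1
  have hEfin : volume E ≠ ⊤ := ne_top_of_le_ne_top (by simp) (measure_mono hEsub)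
  have heB : volume.real E ≤ B := by
    have := measureReal_mono hEsub (by simp) (μ := volume)
    rwa [Real.volume_real_Icc_of_le hab] at this
  rcases (measureReal_nonneg (μ := volume) (s := E)).eq_or_lt with he | he
  · rw [← he, zero_pow hm, mul_zero]
    positivity
  set e := volume.real E with he'
  have hm1 : (0 : ℝ) < 2 * m + 1 := by positivity
  set σ := e / (2 * m + 1) with hσ
  have hσ0 : 0 < σ := div_pos he hm1
  have heσ : e = (2 * m + 1) * σ := by rw [hσ]; field_simp
  have hσB : σ ≤ B := le_trans (by nlinarith [hσ0, (Nat.cast_nonneg m : (0 : ℝ) ≤ m)]) heB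
  obtain ⟨s, hs, hsE, hsep⟩ := exists_separated_of_lt_volume hσ0 m (by
    rw [← ofReal_measureReal hEfin]
    exact (ENNReal.ofReal_lt_ofReal_iff he).2 (by linarith))
  have hprod : ∀ t ⊆ s, ∀ i ∈ s, σ ^ (t.erase i).card ≤ |∏ j ∈ t.erase i, (i - j)| := by
    intro t ht i hi
    rw [Finset.abs_prod, ← Finset.prod_const]
    refine Finset.prod_le_prod (fun _ _ => hσ0.le) fun j hj => ?_
    exact hsep i hi j (ht (Finset.mem_of_mem_erase hj)) (Finset.ne_of_mem_erase hj).symm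
  have hAσ : A * σ ^ m ≤ (m + 1).factorial * ε := by
    obtain ⟨ξ, hξ, h1⟩ := exists_deriv_eq_divided_difference hD hs fun x hx => (hsE x hx).1
    have h2 := hA ξ hξ
    have h3 : |∑ i ∈ s, D 0 i / ∏ j ∈ s.erase i, (i - j)| ≤ (m + 1) * (ε / σ ^ m) := by
      refine (Finset.abs_sum_le_sum_abs _ _).trans ?_
      have : ∀ i ∈ s, |D 0 i / ∏ j ∈ s.erase i, (i - j)| ≤ ε / σ ^ m := by
        intro i hi
        rw [abs_div]
        have h4 := hprod s subset_rfl i hi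
        rw [Finset.card_erase_of_mem hi, hs, Nat.add_sub_cancel] at h4
        exact div_le_div₀ hε.le (hsE i hi).2.le (by positivity) h4
      refine (Finset.sum_le_card_nsmul _ _ _ this).trans ?_
      rw [hs, nsmul_eq_mul]
      push_cast
      rfl
    rw [h1, abs_mul, Nat.abs_cast] at h2
    have h5 := h2.trans (mul_le_mul_of_nonneg_left h3 (Nat.cast_nonneg _))
    calc A * σ ^ m ≤ (m.factorial * ((m + 1) * (ε / σ ^ m))) * σ ^ m :=
          mul_le_mul_of_nonneg_right h5 (by positivity)
      _ = _ := by rw [Nat.factorial_succ]; push_cast; field_simp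
  have hA0 : 0 ≤ A := by
    have := (hA x hx).trans (hA' x hx)
    linarith
  have hmain : |D 0 x| * σ ^ m ≤ (3 * (m + 1).factorial + m + 1) * ε * B ^ m := by
    have hpow : σ ^ m ≤ B ^ m := pow_le_pow_left₀ hσ0.le hσB m
    by_cases hxs : x ∈ s
    · have h1 := (hsE x hxs).2.le
      have h2 : (1 : ℝ) ≤ 3 * (m + 1).factorial + m + 1 := by
        have : (0 : ℝ) ≤ 3 * (m + 1).factorial + m := by positivity
        linarith
      calc |D 0 x| * σ ^ m ≤ ε * B ^ m := mul_le_mul h1 hpow (by positivity) hε.le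
        _ ≤ _ := by
          rw [mul_assoc]
          exact le_mul_of_one_le_left (by positivity) h2
    obtain ⟨y, hy⟩ : s.Nonempty := Finset.card_pos.1 (by omega)
    set t := s.erase y with ht
    have hts : t ⊆ s := Finset.erase_subset _ _
    have htc : t.card = m := by rw [ht, Finset.card_erase_of_mem hy, hs, Nat.add_sub_cancel]
    have hxt : x ∉ t := fun h => hxs (hts h)
    obtain ⟨ξ, hξ, h1⟩ := exists_deriv_eq_divided_difference (m := m) hD (s := insert x t)
      (by rw [Finset.card_insert_of_notMem hxt, htc]) (by
        intro z hz
        rcases Finset.mem_insert.1 hz with rfl | hz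
        · exact hx
        · exact (hsE z (hts hz)).1)
    rw [Finset.sum_insert hxt, Finset.erase_insert hxt] at h1
    have hne : ∏ j ∈ t, (x - j) ≠ 0 := Finset.prod_ne_zero_iff.2 fun j hj =>
      sub_ne_zero.2 fun h => hxt (h ▸ hj)
    have hfac : (m.factorial : ℝ) ≠ 0 := by positivity
    have hform : D 0 x = D m ξ / m.factorial * ∏ j ∈ t, (x - j) +
        ∑ i ∈ t, D 0 i * (∏ j ∈ t.erase i, (x - j)) / ∏ j ∈ t.erase i, (i - j) := by
      rw [h1, mul_div_cancel_left₀ _ hfac, add_mul, div_mul_cancel₀ _ hne, Finset.sum_mul,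
        add_assoc, ← Finset.sum_add_distrib]
      rw [Finset.sum_eq_zero, add_zero]
      intro i hi
      have hix : i ≠ x := fun h => hxt (h ▸ hi)
      rw [Finset.erase_insert_of_ne hix.symm, Finset.prod_insert (fun h => hxt
        (Finset.mem_of_mem_erase h)), ← Finset.mul_prod_erase t _ hi]
      have h2 : ∏ j ∈ t.erase i, (i - j) ≠ 0 := Finset.prod_ne_zero_iff.2 fun j hj =>
        sub_ne_zero.2 (Finset.ne_of_mem_erase hj).symm
      have h3 : i - x ≠ 0 := sub_ne_zero.2 hix
      field_simp
      ring
    have hxB : ∀ u ⊆ s, |∏ j ∈ u, (x - j)| ≤ B ^ u.card := by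
      intro u hu
      rw [Finset.abs_prod, ← Finset.prod_const]
      refine Finset.prod_le_prod (fun _ _ => abs_nonneg _) fun j hj => ?_
      have h5 := (hsE j (hu hj)).1
      rw [abs_le]
      constructor <;> linarith [hx.1, hx.2, h5.1, h5.2]
    have hT1 : |D m ξ / m.factorial * ∏ j ∈ t, (x - j)| ≤ 3 * A * B ^ m := by
      rw [abs_mul, abs_div, Nat.abs_cast]
      have h5 := hxB t hts
      rw [htc] at h5
      refine mul_le_mul ((div_le_self (abs_nonneg _) ?_).trans (hA' ξ hξ)) h5 (abs_nonneg _)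
        (by positivity)
      exact_mod_cast Nat.one_le_iff_ne_zero.2 (Nat.factorial_ne_zero m)
    have hT2 : |∑ i ∈ t, D 0 i * (∏ j ∈ t.erase i, (x - j)) / ∏ j ∈ t.erase i, (i - j)| * σ ^ m
        ≤ m * (ε * B ^ m) := by
      rw [← abs_of_pos (pow_pos hσ0 m), ← abs_mul, Finset.sum_mul]
      refine (Finset.abs_sum_le_sum_abs _ _).trans ?_
      have : ∀ i ∈ t, |D 0 i * (∏ j ∈ t.erase i, (x - j)) / (∏ j ∈ t.erase i, (i - j)) * σ ^ m|
          ≤ ε * B ^ m := by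
        intro i hi
        have hc : (t.erase i).card = m - 1 := by rw [Finset.card_erase_of_mem hi, htc]
        have h4 := hprod t hts i (hts hi)
        have h5 := hxB (t.erase i) ((Finset.erase_subset _ _).trans hts)
        rw [hc] at h4 h5
        obtain ⟨r, rfl⟩ := Nat.exists_eq_succ_of_ne_zero hm
        rw [Nat.succ_sub_one] at h4 h5
        have h6 : 0 < |∏ j ∈ t.erase i, (i - j)| := lt_of_lt_of_le (by positivity) h4
        rw [abs_mul, abs_div, abs_mul, abs_of_pos (pow_pos hσ0 _), div_mul_eq_mul_div,
          div_le_iff₀ h6, pow_succ, pow_succ]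
        have h7 : |D 0 i| * |∏ j ∈ t.erase i, (x - j)| ≤ ε * B ^ r :=
          mul_le_mul (hsE i (hts hi)).2.le h5 (abs_nonneg _) hε.le
        have h8 : σ ^ r * σ ≤ |∏ j ∈ t.erase i, (i - j)| * B :=
          mul_le_mul h4 hσB hσ0.le h6.le
        calc _ ≤ (ε * B ^ r) * (|∏ j ∈ t.erase i, (i - j)| * B) :=
              mul_le_mul h7 h8 (by positivity) (by positivity)
          _ = _ := by ring
      refine (Finset.sum_le_card_nsmul _ _ _ this).trans ?_
      rw [htc, nsmul_eq_mul]
    have h9 : |D 0 x| ≤ 3 * A * B ^ m +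
        |∑ i ∈ t, D 0 i * (∏ j ∈ t.erase i, (x - j)) / ∏ j ∈ t.erase i, (i - j)| := by
      rw [hform]
      exact (abs_add_le _ _).trans (add_le_add_left hT1 _)
    calc |D 0 x| * σ ^ m ≤ 3 * B ^ m * (A * σ ^ m) +
        |∑ i ∈ t, D 0 i * (∏ j ∈ t.erase i, (x - j)) / ∏ j ∈ t.erase i, (i - j)| * σ ^ m := by
          refine (mul_le_mul_of_nonneg_right h9 (by positivity)).trans (le_of_eq ?_)
          ring
      _ ≤ 3 * B ^ m * ((m + 1).factorial * ε) + m * (ε * B ^ m) :=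
          add_le_add (mul_le_mul_of_nonneg_left hAσ (by positivity)) hT2
      _ ≤ _ := by
          have : 0 ≤ ε * B ^ m := by positivity
          nlinarith
  calc |D 0 x| * e ^ m = (|D 0 x| * σ ^ m) * (2 * m + 1) ^ m := by rw [heσ, mul_pow]; ring
    _ ≤ ((3 * (m + 1).factorial + m + 1) * ε * B ^ m) * (2 * m + 1) ^ m :=
        mul_le_mul_of_nonneg_right hmain (by positivity)
    _ = _ := by ring

theorem exists_abs_apply_le {E : Type*} [NormedAddCommGroup E] [NormedSpace ℝ E]
    [FiniteDimensional ℝ E] {l : ℕ} (v : Fin l → E) :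
    ∃ C : ℝ, 0 ≤ C ∧ ∀ (c : E →L[ℝ] ℝ) (N : ℝ), (∀ i, |c (v i)| ≤ N) →
      ∀ w ∈ Submodule.span ℝ (Set.range v), |c w| ≤ C * ‖w‖ * N := by
  obtain ⟨S, hS⟩ := LinearMap.exists_rightInverse_of_surjective
    (Fintype.linearCombination ℝ v).rangeRestrict (LinearMap.range_rangeRestrict _)
  set S' := LinearMap.toContinuousLinearMap S with hS'
  refine ⟨l * ‖S'‖, by positivity, fun c N hN w hw => ?_⟩
  rw [← Fintype.range_linearCombination] at hw
  have h1 : w = ∑ i, S ⟨w, hw⟩ i • v i := by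
    have := congrArg Subtype.val (LinearMap.congr_fun hS ⟨w, hw⟩)
    simpa [Fintype.linearCombination_apply] using this.symm
  have h2 : ∀ i, |S ⟨w, hw⟩ i * c (v i)| ≤ ‖S'‖ * ‖w‖ * N := by
    intro i
    rw [abs_mul]
    have h3 : |S ⟨w, hw⟩ i| ≤ ‖S'‖ * ‖w‖ := by
      have h4 := norm_le_pi_norm (S ⟨w, hw⟩) i
      exact h4.trans (S'.le_opNorm ⟨w, hw⟩)
    exact mul_le_mul h3 (hN i) (abs_nonneg _) (by positivity)
  conv_lhs => rw [h1]
  rw [map_sum]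
  simp only [map_smul, smul_eq_mul]
  refine (Finset.abs_sum_le_sum_abs _ _).trans
    ((Finset.sum_le_card_nsmul _ _ _ fun i _ => h2 i).trans (le_of_eq ?_))
  rw [Finset.card_univ, Fintype.card_fin, nsmul_eq_mul]
  ring

/-- Near a point where its derivatives span the direction of the affine subspace it lives in, a
curve composed with arbitrary affine functionals is good, uniformly in the functional. -/
theorem exists_uniformly_good {E : Type*} [NormedAddCommGroup E] [NormedSpace ℝ E]
    [FiniteDimensional ℝ E] {D : ℕ → ℝ → E} {t₀ δ₀ : ℝ} (hδ₀ : 0 < δ₀) {l : ℕ}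
    (hD : ∀ k, ∀ x ∈ Set.Icc (t₀ - δ₀) (t₀ + δ₀), HasDerivAt (D k) (D (k + 1) x) x)
    (hspan : ∀ k, ∀ x ∈ Set.Icc (t₀ - δ₀) (t₀ + δ₀),
      D (k + 1) x ∈ Submodule.span ℝ (Set.range fun i : Fin l => D (i + 1) t₀)) :
    ∃ δ, 0 < δ ∧ δ ≤ δ₀ ∧ ∃ K : ℝ, 0 ≤ K ∧ ∀ (c₀ : ℝ) (c : E →L[ℝ] ℝ) (a b : ℝ),
      t₀ - δ ≤ a → b ≤ t₀ + δ → ∀ x ∈ Set.Icc a b, ∀ ε, 0 < ε →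
        |c₀ + c (D 0 x)| * volume.real {y ∈ Set.Icc a b | |c₀ + c (D 0 y)| < ε} ^ (l + 1) ≤
          K * ε * (b - a) ^ (l + 1) := by
  obtain ⟨C, hC0, hC⟩ := exists_abs_apply_le fun i : Fin l => D (i + 1) t₀
  have ht₀ : t₀ ∈ Set.Icc (t₀ - δ₀) (t₀ + δ₀) := ⟨by linarith, by linarith⟩
  have hcont : ∀ i : Fin l, ∀ᶠ t in nhds t₀, C * ‖D (i + 1) t - D (i + 1) t₀‖ ≤ 1 / 2 := by
    intro i
    have h1 : Filter.Tendsto (fun t => C * ‖D (i + 1) t - D (i + 1) t₀‖) (nhds t₀) (nhds 0) := by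
      have : ContinuousAt (fun t => C * ‖D (i + 1) t - D (i + 1) t₀‖) t₀ :=
        ((hD (i + 1) t₀ ht₀).continuousAt.sub continuousAt_const).norm.const_mul C
      simpa [ContinuousAt] using this
    exact h1.eventually (Iic_mem_nhds (by norm_num))
  obtain ⟨δ₁, hδ₁, hball⟩ := Metric.eventually_nhds_iff.1 (Filter.eventually_all.2 hcont)
  refine ⟨min δ₀ (δ₁ / 2), by positivity, min_le_left _ _,
    (3 * (l + 1).factorial + l + 1) * (2 * l + 1) ^ l, by positivity, ?_⟩
  intro c₀ c a b ha hb x hx ε hε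
  have hab : a ≤ b := hx.1.trans hx.2
  have hIcc : Set.Icc a b ⊆ Set.Icc (t₀ - δ₀) (t₀ + δ₀) :=
    Set.Icc_subset_Icc (by linarith [min_le_left δ₀ (δ₁ / 2)])
      (by linarith [min_le_left δ₀ (δ₁ / 2)])
  have hnear : ∀ y ∈ Set.Icc a b, ∀ i : Fin l, C * ‖D (i + 1) y - D (i + 1) t₀‖ ≤ 1 / 2 := by
    intro y hy
    refine hball ?_
    rw [Real.dist_eq, abs_lt]
    constructor <;> linarith [min_le_right δ₀ (δ₁ / 2), hy.1, hy.2]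
  set e := volume.real {y ∈ Set.Icc a b | |c₀ + c (D 0 y)| < ε} with he
  have he0 : 0 ≤ e := measureReal_nonneg
  have heB : e ≤ b - a := by
    have := measureReal_mono (μ := volume)
      (fun y hy => hy.1 : {y ∈ Set.Icc a b | |c₀ + c (D 0 y)| < ε} ⊆ Set.Icc a b) (by simp)
    rwa [Real.volume_real_Icc_of_le hab] at this
  have hK1 : (1 : ℝ) ≤ (3 * (l + 1).factorial + l + 1) * (2 * l + 1) ^ l := by
    refine one_le_mul_of_one_le_of_one_le ?_ (one_le_pow₀ ?_)
    · have : (0 : ℝ) ≤ 3 * (l + 1).factorial + l := by positivity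
      linarith
    · have : (0 : ℝ) ≤ 2 * l := by positivity
      linarith
  by_cases hN : ∀ i : Fin l, c (D (i + 1) t₀) = 0
  · have hc0 : ∀ y ∈ Set.Icc a b, c (D 1 y) = 0 := by
      intro y hy
      have := hC c 0 (fun i => by rw [hN i, abs_zero]) _ (hspan 0 y (hIcc hy))
      rw [mul_zero] at this
      exact abs_nonpos_iff.1 this
    have hder : ∀ y ∈ Set.Icc a b, HasDerivAt (fun y => c (D 0 y)) 0 y := by
      intro y hy
      have h1 := c.hasFDerivAt.comp_hasDerivAt y (hD 0 y (hIcc hy))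
      rw [zero_add, hc0 y hy] at h1
      exact h1
    have hconst := constant_of_has_deriv_right_zero
      (fun y hy => (hder y hy).continuousAt.continuousWithinAt)
      (fun y hy => (hder y (Set.Ico_subset_Icc_self hy)).hasDerivWithinAt)
    by_cases hlt : |c₀ + c (D 0 x)| < ε
    · calc _ ≤ ε * (b - a) ^ (l + 1) :=
          mul_le_mul hlt.le (pow_le_pow_left₀ he0 heB _) (by positivity) hε.le
        _ ≤ _ := by
          rw [mul_assoc]
          exact le_mul_of_one_le_left
            (mul_nonneg hε.le (pow_nonneg (sub_nonneg.2 hab) _)) hK1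
    · have : {y ∈ Set.Icc a b | |c₀ + c (D 0 y)| < ε} = ∅ := by
        rw [Set.eq_empty_iff_forall_notMem]
        rintro y ⟨hy, hy'⟩
        apply hlt
        rwa [hconst x hx, ← hconst y hy]
      rw [he, this, measureReal_empty, zero_pow (Nat.succ_ne_zero _), mul_zero]
      exact mul_nonneg (by positivity) (pow_nonneg (sub_nonneg.2 hab) _)
  · push Not at hN
    obtain ⟨i₁, hi₁⟩ := hN
    have : Nonempty (Fin l) := ⟨i₁⟩
    obtain ⟨i, hi⟩ := Finite.exists_max fun i : Fin l => |c (D (i + 1) t₀)|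
    set N := |c (D (i + 1) t₀)| with hNdef
    have hbound : ∀ y ∈ Set.Icc a b, |c (D (i + 1) y) - c (D (i + 1) t₀)| ≤ N / 2 := by
      intro y hy
      have h1 := hC c N hi (D (i + 1) y - D (i + 1) t₀)
        (Submodule.sub_mem _ (hspan i y (hIcc hy)) (hspan i t₀ ht₀))
      rw [map_sub] at h1
      have h2 := mul_le_mul_of_nonneg_right (hnear y hy i) (abs_nonneg _ : 0 ≤ N)
      linarith
    have hm := abs_mul_volume_pow_le (m := i + 1) (A := N / 2) (ε := ε) (a := a) (b := b)
      (Nat.succ_ne_zero i) (D := fun k y => if k = 0 then c₀ + c (D 0 y) else c (D k y)) ?_ ?_ ?_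
      hε hx
    · simp only [if_true] at hm
      rw [← he] at hm
      have hil : (i : ℕ) + 1 ≤ l := i.2
      obtain ⟨r, hr⟩ := Nat.exists_eq_add_of_le (hil.trans (Nat.le_succ l))
      have hKle : (3 * ((i : ℕ) + 1 + 1).factorial + ((i + 1 : ℕ) : ℝ) + 1) *
          (2 * ((i + 1 : ℕ) : ℝ) + 1) ^ ((i : ℕ) + 1) ≤
          (3 * (l + 1).factorial + l + 1) * (2 * l + 1) ^ l := by
        have h1 : (((i : ℕ) + 1 : ℕ) : ℝ) ≤ l := by exact_mod_cast hil
        have h2 : ((((i : ℕ) + 1 + 1).factorial : ℕ) : ℝ) ≤ (l + 1).factorial := by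
          exact_mod_cast Nat.factorial_le (Nat.succ_le_succ hil)
        refine mul_le_mul (by linarith) ?_ (by positivity) (by positivity)
        refine (pow_le_pow_left₀ (by positivity) (by linarith) _).trans
          (pow_le_pow_right₀ ?_ hil)
        have : (0 : ℝ) ≤ 2 * l := by positivity
        linarith
      have hBr : 0 ≤ b - a := sub_nonneg.2 hab
      calc |c₀ + c (D 0 x)| * e ^ (l + 1) = |c₀ + c (D 0 x)| * e ^ ((i : ℕ) + 1) * e ^ r := by
            rw [show l + 1 = (i : ℕ) + 1 + r from hr, pow_add]; ring
        _ ≤ ((3 * (l + 1).factorial + l + 1) * (2 * l + 1) ^ l * ε * (b - a) ^ ((i : ℕ) + 1)) *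
            (b - a) ^ r := by
            refine mul_le_mul (hm.trans ?_) (pow_le_pow_left₀ he0 heB _) (by positivity)
              (by positivity)
            exact mul_le_mul_of_nonneg_right (mul_le_mul_of_nonneg_right hKle hε.le)
              (by positivity)
        _ = _ := by
            rw [show l + 1 = (i : ℕ) + 1 + r from hr, pow_add _ _ r]; ring
    · intro k y hy
      have h1 := c.hasFDerivAt.comp_hasDerivAt y (hD k y (hIcc hy))
      rcases k with - | k
      · simpa using h1.const_add c₀
      · simp only [Nat.succ_ne_zero, if_false]
        exact h1
    · intro y hy
      have h1 := abs_le.1 (hbound y hy)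
      simp only [Nat.succ_ne_zero, if_false]
      have h2 := abs_sub_abs_le_abs_sub (c (D (i + 1) t₀)) (c (D (i + 1) y))
      rw [abs_sub_comm] at h2
      linarith [hbound y hy]
    · intro y hy
      simp only [Nat.succ_ne_zero, if_false]
      have h2 := abs_sub_abs_le_abs_sub (c (D (i + 1) y)) (c (D (i + 1) t₀))
      linarith [hbound y hy]

section Dynamics

open Matrix

variable {n : ℕ}

/-- The product of the unipotent matrix attached to `y` and the diagonal matrix
`diag(R ^ n, R⁻¹, …, R⁻¹)`, acting on row vectors. -/
noncomputable def flowMatrix (R : ℝ) (y : Fin n → ℝ) : Matrix (Fin (n + 1)) (Fin (n + 1)) ℝ :=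
  Matrix.of fun i j => Fin.cases (R ^ n * (Fin.cons 1 y : Fin (n + 1) → ℝ) i)
    (fun j' => if i = j'.succ then R⁻¹ else 0) j

theorem vecMul_flowMatrix_zero (R : ℝ) (y : Fin n → ℝ) (v : Fin (n + 1) → ℝ) :
    (v ᵥ* flowMatrix R y) 0 = R ^ n * (v 0 + ∑ i, y i * v i.succ) := by
  simp only [Matrix.vecMul, dotProduct, flowMatrix, of_apply, Fin.cases_zero]
  rw [Fin.sum_univ_succ, mul_add, Finset.mul_sum]
  simp only [Fin.cons_zero, Fin.cons_succ]
  congr 1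
  · ring
  · exact Finset.sum_congr rfl fun i _ => by ring

theorem vecMul_flowMatrix_succ (R : ℝ) (y : Fin n → ℝ) (v : Fin (n + 1) → ℝ) (j : Fin n) :
    (v ᵥ* flowMatrix R y) j.succ = R⁻¹ * v j.succ := by
  simp [Matrix.vecMul, dotProduct, flowMatrix, mul_comm]

theorem mul_flowMatrix_apply_succ {ι : Type*} (B : Matrix ι (Fin (n + 1)) ℝ) (R : ℝ)
    (y : Fin n → ℝ) (a : ι) (j : Fin n) : (B * flowMatrix R y) a j.succ = R⁻¹ * B a j.succ :=
  vecMul_flowMatrix_succ R y (B a) j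

theorem isUnit_det_flowMatrix {R : ℝ} (hR : R ≠ 0) (y : Fin n → ℝ) :
    IsUnit (flowMatrix R y).det := by
  rw [isUnit_iff_ne_zero, Matrix.det_of_isLowerTriangular]
  · rw [Finset.prod_ne_zero_iff]
    intro i _
    refine Fin.cases ?_ (fun i => ?_) i
    · simp [flowMatrix, hR]
    · simp [flowMatrix, hR]
  · intro i j hij
    rw [OrderDual.toDual_lt_toDual] at hij
    obtain ⟨j', rfl⟩ := Fin.exists_succ_eq.2 (Fin.ne_zero_of_lt hij)
    have : i ≠ j'.succ := hij.ne
    simp [flowMatrix, this]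

theorem exists_minors_mul_flowMatrix_eq {j : ℕ} (B : Matrix (Fin j) (Fin (n + 1)) ℝ) (R : ℝ)
    (σ : Fin j → Fin (n + 1)) :
    ∃ (c₀ : ℝ) (c : (Fin n → ℝ) →L[ℝ] ℝ), ∀ y, minors (B * flowMatrix R y) σ = c₀ + c y := by
  by_cases hσ : Function.Injective σ
  swap
  · obtain ⟨a, b, hab, hne⟩ : ∃ a b, σ a = σ b ∧ a ≠ b := by
      simpa [Function.Injective] using hσ
    refine ⟨0, 0, fun y => ?_⟩
    rw [minors, Matrix.det_zero_of_column_eq hne (fun i => by simp [hab])]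
    simp
  by_cases h0 : ∃ a, σ a = 0
  swap
  · push Not at h0
    refine ⟨minors (B * flowMatrix R 0) σ, 0, fun y => ?_⟩
    rw [_root_.zero_apply, add_zero, minors, minors]
    congr 1
    ext a b
    obtain ⟨b', hb'⟩ := Fin.exists_succ_eq.2 (h0 b)
    rw [submatrix_apply, submatrix_apply, ← hb']
    exact (mul_flowMatrix_apply_succ B R y a b').trans (mul_flowMatrix_apply_succ B R 0 a b').symm
  obtain ⟨a, ha⟩ := h0
  let M := (B * flowMatrix R 0).submatrix id σ
  let ℓ : (Fin (n + 1) → ℝ) →ₗ[ℝ] ℝ :=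
    (LinearMap.proj a).comp ((Matrix.cramer M).comp (R ^ n • B.mulVecLin))
  let κ : (Fin n → ℝ) →ₗ[ℝ] (Fin (n + 1) → ℝ) :=
    { toFun := fun y => Fin.cons 0 y
      map_add' := fun y z => by
        funext i
        refine Fin.cases ?_ (fun i => ?_) i <;> simp
      map_smul' := fun r y => by
        funext i
        refine Fin.cases ?_ (fun i => ?_) i <;> simp }
  refine ⟨ℓ (Fin.cons 1 0), LinearMap.toContinuousLinearMap (ℓ.comp κ), fun y => ?_⟩
  have h1 : (Fin.cons 1 y : Fin (n + 1) → ℝ) = Fin.cons 1 0 + κ y := by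
    funext i
    refine Fin.cases ?_ (fun i => ?_) i <;> simp [κ]
  rw [LinearMap.coe_toContinuousLinearMap', LinearMap.comp_apply ℓ, ← map_add ℓ, ← h1]
  simp only [ℓ, LinearMap.comp_apply, LinearMap.proj_apply, Matrix.cramer_apply, minors]
  congr 1
  ext r c
  by_cases hc : c = a
  · subst hc
    simp only [submatrix_apply, id, updateCol_self, ha, Matrix.mul_apply, flowMatrix, of_apply,
      Fin.cases_zero, LinearMap.smul_apply, Pi.smul_apply, smul_eq_mul, Matrix.mulVecLin_apply,
      Matrix.mulVec, dotProduct, Finset.mul_sum]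
    exact Finset.sum_congr rfl fun i _ => by ring
  · obtain ⟨c', hc'⟩ := Fin.exists_succ_eq.2 (fun h => hc (hσ (h.trans ha.symm)))
    rw [updateCol_ne hc]
    change (B * flowMatrix R y) r (σ c) = (B * flowMatrix R (0 : Fin n → ℝ)) r (σ c)
    rw [← hc']
    exact (mul_flowMatrix_apply_succ B R y r c').trans (mul_flowMatrix_apply_succ B R 0 r c').symm

end Dynamics

section Diophantine

open Matrix

variable {n : ℕ}

theorem one_le_norm_intCast {q : Fin n → ℤ} (hq : q ≠ 0) :
    1 ≤ ‖(fun i => (q i : ℝ) : Fin n → ℝ)‖ := by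
  obtain ⟨i, hi⟩ := Function.ne_iff.1 hq
  refine le_trans ?_ (norm_le_pi_norm _ i)
  rw [Real.norm_eq_abs, ← Int.cast_abs]
  exact_mod_cast Int.one_le_abs hi

theorem finite_norm_intCast_le (T : ℝ) :
    {q : Fin n → ℤ | ‖(fun i => (q i : ℝ) : Fin n → ℝ)‖ ≤ T}.Finite := by
  refine (Set.finite_Icc (fun _ => -⌈T⌉) (fun _ => ⌈T⌉)).subset fun q hq => ?_
  have h : ∀ i, |q i| ≤ ⌈T⌉ := by
    intro i
    have h1 := ((norm_le_pi_norm (fun i => (q i : ℝ)) i).trans hq).trans (Int.le_ceil T)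
    rw [Real.norm_eq_abs, ← Int.cast_abs] at h1
    exact_mod_cast h1
  exact ⟨fun i => (abs_le.1 (h i)).1, fun i => (abs_le.1 (h i)).2⟩

theorem InW.mono {y : Fin n → ℝ} {v w : ℝ} (hw : 0 < w) (hwv : w ≤ v) (h : InW y v) :
    InW y w := by
  refine Set.Infinite.mono (fun q hq => ?_) h
  obtain ⟨p, hp⟩ := hq
  refine ⟨p, hp.trans ?_⟩
  by_cases hq0 : q = 0
  · subst hq0
    have h0 : ‖(fun i => (((0 : Fin n → ℤ) i : ℤ) : ℝ) : Fin n → ℝ)‖ = 0 := by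
      rw [norm_eq_zero]; funext i; simp
    rw [h0, Real.zero_rpow (by linarith), Real.zero_rpow (by linarith)]
  · exact Real.rpow_le_rpow_of_exponent_le (one_le_norm_intCast hq0) (neg_le_neg hwv)

theorem measurableSet_inW (v : ℝ) : MeasurableSet {y : Fin n → ℝ | InW y v} := by
  have h : {y : Fin n → ℝ | InW y v} = ⋂ F : Finset (Fin n → ℤ), ⋃ q : Fin n → ℤ, ⋃ (_ : q ∉ F),
      ⋃ p : ℤ, {y | |(∑ i, y i * (q i : ℝ)) + (p : ℝ)| ≤
        ‖(fun i => (q i : ℝ) : Fin n → ℝ)‖ ^ (-v)} := by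
    ext y
    simp only [Set.mem_iInter, Set.mem_iUnion, Set.mem_ofPred_eq, exists_prop]
    constructor
    · intro h F
      obtain ⟨q, hq, hqF⟩ := Set.Infinite.exists_notMem_finset h F
      exact ⟨q, hqF, hq⟩
    · intro h hfin
      obtain ⟨q, hq, hq'⟩ := h hfin.toFinset
      exact hq (hfin.mem_toFinset.2 hq')
  rw [h]
  refine MeasurableSet.iInter fun F => MeasurableSet.iUnion fun q => MeasurableSet.iUnion fun _ =>
    MeasurableSet.iUnion fun p => ?_
  exact measurableSet_le (by fun_prop) measurable_const

theorem measurableSet_isVWA : MeasurableSet {y : Fin n → ℝ | IsVWA y} := by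
  have h : {y : Fin n → ℝ | IsVWA y} = ⋃ m : ℕ, {y | InW y (n + 1 / ((m : ℝ) + 1))} := by
    ext y
    simp only [Set.mem_iUnion, Set.mem_ofPred_eq]
    constructor
    · rintro ⟨v, hv, h⟩
      obtain ⟨m, hm⟩ := exists_nat_one_div_lt (sub_pos.2 hv)
      exact ⟨m, h.mono (by positivity) (by linarith)⟩
    · rintro ⟨m, h⟩
      exact ⟨_, lt_add_of_pos_right _ (by positivity), h⟩
  rw [h]
  exact MeasurableSet.iUnion fun m => measurableSet_inW _

theorem IsVWA.exists_frequently_norm_le {y : Fin n → ℝ} (h : IsVWA y) :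
    ∃ γ : ℝ, 0 < γ ∧ ∃ᶠ t : ℕ in Filter.atTop, ∃ v : Fin (n + 1) → ℤ, v ≠ 0 ∧
      ‖(fun i => (v i : ℝ)) ᵥ* flowMatrix (2 ^ t) y‖ ≤ (2 : ℝ) ^ (-(γ * t)) := by
  obtain ⟨w, hw, hinf⟩ := h
  have hn : (0 : ℝ) ≤ n := Nat.cast_nonneg n
  obtain ⟨γ, hγ0, hγ1, hγ⟩ : ∃ γ : ℝ, 0 < γ ∧ γ < 1 ∧ n + γ < w * (1 - γ) := by
    refine ⟨(w - n) / (2 * (1 + w)), ?_, ?_, ?_⟩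
    · exact div_pos (by linarith) (by linarith)
    · rw [div_lt_one (by linarith)]; linarith
    · have : (w - n) / (2 * (1 + w)) * (1 + w) = (w - n) / 2 := by
        field_simp
        rw [mul_div_assoc, div_self (by linarith : (1 + w) ≠ 0), mul_one]
      nlinarith
  refine ⟨γ, hγ0, ?_⟩
  rw [Filter.frequently_atTop]
  intro t₀
  set η := w * (1 - γ) - (n + γ) with hη
  have hη0 : 0 < η := by linarith
  obtain ⟨q, ⟨p, hp⟩, hq⟩ := hinf.exists_notMem_finite
    (finite_norm_intCast_le ((2 : ℝ) ^ (max (t₀ : ℝ) (w * (1 - γ) / η))))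
  set Q := ‖(fun i => (q i : ℝ) : Fin n → ℝ)‖ with hQ
  simp only [Set.mem_ofPred_eq, not_le] at hq
  have hQ0 : 0 < Q := lt_trans (by positivity) hq
  set r := Real.logb 2 Q with hr
  have hQr : Q = (2 : ℝ) ^ r := (Real.rpow_logb (by norm_num) (by norm_num) hQ0).symm
  rw [← hQ, hQr, Real.rpow_lt_rpow_left_iff (by norm_num)] at hq
  have hrt : (t₀ : ℝ) < r := (le_max_left _ _).trans_lt hq
  have hrη : w * (1 - γ) / η < r := (le_max_right _ _).trans_lt hq
  rw [div_lt_iff₀ hη0] at hrη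
  have hr0 : 0 ≤ r := le_trans (Nat.cast_nonneg _) hrt.le
  have h1γ : 0 < 1 - γ := by linarith
  set t := ⌈r / (1 - γ)⌉₊ with ht
  have ht1 : r ≤ t * (1 - γ) := by
    rw [← div_le_iff₀ h1γ]; exact Nat.le_ceil _
  have ht2 : (t : ℝ) * (1 - γ) < r + (1 - γ) := by
    have := Nat.ceil_lt_add_one (div_nonneg hr0 h1γ.le)
    rw [← lt_div_iff₀ h1γ, add_div, div_self h1γ.ne']
    exact this
  have ht3 : (t₀ : ℝ) ≤ t := by
    have : (t : ℝ) * (1 - γ) ≤ t := mul_le_of_le_one_right (Nat.cast_nonneg _) (by linarith)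
    linarith
  refine ⟨t, by exact_mod_cast ht3, Fin.cons p q, ?_, ?_⟩
  · intro h0
    have hq0 : q = 0 := by
      funext i
      have := congrFun h0 i.succ
      simpa using this
    rw [hQ, hq0] at hQ0
    simp at hQ0
    exact (hQ0 rfl).elim
  have h2t : ((2 : ℝ) ^ t) = (2 : ℝ) ^ (t : ℝ) := (Real.rpow_natCast _ _).symm
  rw [pi_norm_le_iff_of_nonneg (by positivity)]
  intro i
  refine Fin.cases ?_ (fun i => ?_) i
  · rw [vecMul_flowMatrix_zero, Real.norm_eq_abs, abs_mul]
    simp only [Fin.cons_zero, Fin.cons_succ]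
    rw [add_comm, abs_of_pos (by positivity), h2t, ← Real.rpow_natCast, ← Real.rpow_mul (by norm_num)]
    rw [hQr, ← Real.rpow_mul (by norm_num)] at hp
    refine (mul_le_mul_of_nonneg_left hp (by positivity)).trans ?_
    rw [← Real.rpow_add (by norm_num)]
    refine Real.rpow_le_rpow_of_exponent_le (by norm_num) ?_
    have h5 : (t : ℝ) * (1 - γ) * (n + γ) ≤ (r + (1 - γ)) * (n + γ) :=
      mul_le_mul_of_nonneg_right ht2.le (by linarith)
    have h6 : (1 - γ) * (t * (n + γ)) ≤ (1 - γ) * (r * w) := by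
      have h7 : (1 - γ) * (n + γ) ≤ w * (1 - γ) := by nlinarith
      nlinarith
    have := le_of_mul_le_mul_left h6 h1γ
    linarith
  · rw [vecMul_flowMatrix_succ, Real.norm_eq_abs, abs_mul]
    simp only [Fin.cons_succ]
    have h5 : |(q i : ℝ)| ≤ Q := norm_le_pi_norm (fun i => (q i : ℝ)) i
    rw [abs_of_pos (by positivity), h2t, ← Real.rpow_neg (by norm_num)]
    refine (mul_le_mul_of_nonneg_left h5 (by positivity)).trans ?_
    rw [hQr, ← Real.rpow_add (by norm_num)]
    refine Real.rpow_le_rpow_of_exponent_le (by norm_num) ?_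
    linarith

theorem eventually_le_norm_of_not_isVWA {y : Fin n → ℝ} (h : ¬ IsVWA y) {β : ℝ} (hβ : 0 < β) :
    ∀ᶠ t : ℕ in Filter.atTop, ∀ v : Fin (n + 1) → ℤ, v ≠ 0 →
      (2 : ℝ) ^ (-(β * t)) ≤ ‖(fun i => (v i : ℝ)) ᵥ* flowMatrix (2 ^ t) y‖ := by
  by_contra hcon
  rw [Filter.not_eventually] at hcon
  push Not at hcon
  set S := {q : Fin n → ℤ | ∃ p : ℤ, |(∑ i, y i * (q i : ℝ)) + (p : ℝ)| ≤
      ‖(fun i => (q i : ℝ) : Fin n → ℝ)‖ ^ (-(n + β))} with hS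
  have hSfin : S.Finite := by
    by_contra hinf
    exact h ⟨n + β, by linarith, hinf⟩
  have hn : (0 : ℝ) ≤ n := Nat.cast_nonneg n
  have hnβ : 0 < n + β := by linarith
  have key : ∃ᶠ t : ℕ in Filter.atTop, ∃ q ∈ S, q ≠ 0 ∧ ∃ p : ℤ,
      |(∑ i, y i * (q i : ℝ)) + (p : ℝ)| ≤ (2 : ℝ) ^ (-((n + β) * t)) := by
    refine hcon.mono ?_
    rintro t ⟨v, hv, hlt⟩
    have ht0 : (0 : ℝ) ≤ t := Nat.cast_nonneg t
    have h2t : ((2 : ℝ) ^ t) = (2 : ℝ) ^ (t : ℝ) := (Real.rpow_natCast _ _).symm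
    have h1 := (norm_le_pi_norm _ 0).trans_lt hlt
    rw [vecMul_flowMatrix_zero, Real.norm_eq_abs, abs_mul, abs_of_pos (by positivity), h2t,
      ← Real.rpow_natCast, ← Real.rpow_mul (by norm_num), add_comm] at h1
    have h2 : |(∑ i, y i * (v i.succ : ℝ)) + (v 0 : ℝ)| ≤ (2 : ℝ) ^ (-((n + β) * t)) := by
      rw [mul_comm, ← lt_div_iff₀ (by positivity), ← Real.rpow_sub (by norm_num)] at h1
      refine h1.le.trans (le_of_eq ?_)
      congr 1
      ring
    have hq0 : (fun i : Fin n => v i.succ) ≠ 0 := by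
      intro hq0
      have hv0 : v 0 ≠ 0 := by
        intro h0
        apply hv
        funext i
        refine Fin.cases h0 (fun i => congrFun hq0 i) i
      have h3 : (1 : ℝ) ≤ |(v 0 : ℝ)| := by
        rw [← Int.cast_abs]; exact_mod_cast Int.one_le_abs hv0
      have h4 : ∀ i : Fin n, (v i.succ : ℝ) = 0 := fun i => by
        have := congrFun hq0 i
        simpa using this
      simp only [h4, mul_zero, Finset.sum_const_zero, zero_add] at h1
      have h5 : (2 : ℝ) ^ (-(β * t)) ≤ 1 :=
        Real.rpow_le_one_of_one_le_of_nonpos (by norm_num) (by nlinarith)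
      have h6 : (1 : ℝ) ≤ (2 : ℝ) ^ ((t : ℝ) * n) :=
        Real.one_le_rpow (by norm_num) (by positivity)
      nlinarith
    refine ⟨_, ⟨v 0, h2.trans ?_⟩, hq0, v 0, h2⟩
    have hQ1 := one_le_norm_intCast hq0
    have hQt : ‖(fun i => (v i.succ : ℝ) : Fin n → ℝ)‖ ≤ (2 : ℝ) ^ (t : ℝ) := by
      rw [pi_norm_le_iff_of_nonneg (by positivity)]
      intro i
      have h3 := (norm_le_pi_norm _ i.succ).trans_lt hlt
      rw [vecMul_flowMatrix_succ, norm_mul, Real.norm_eq_abs, abs_of_pos (by positivity), h2t,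
        inv_mul_lt_iff₀ (by positivity)] at h3
      refine h3.le.trans (mul_le_of_le_one_right (by positivity) ?_)
      exact Real.rpow_le_one_of_one_le_of_nonpos (by norm_num) (by nlinarith)
    calc (2 : ℝ) ^ (-((n + β) * t)) = ((2 : ℝ) ^ (t : ℝ)) ^ (-(n + β)) := by
          rw [← Real.rpow_mul (by norm_num)]; congr 1; ring
      _ ≤ _ := Real.rpow_le_rpow_of_nonpos (by linarith) hQt (by linarith)
  obtain ⟨q, hqS, hq0, hq⟩ : ∃ q ∈ S, q ≠ 0 ∧ ∃ᶠ t : ℕ in Filter.atTop, ∃ p : ℤ,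
      |(∑ i, y i * (q i : ℝ)) + (p : ℝ)| ≤ (2 : ℝ) ^ (-((n + β) * t)) := by
    by_contra hno
    push Not at hno
    have hall : ∀ q ∈ S, ∀ᶠ t : ℕ in Filter.atTop, ¬ (q ≠ 0 ∧ ∃ p : ℤ,
        |(∑ i, y i * (q i : ℝ)) + (p : ℝ)| ≤ (2 : ℝ) ^ (-((n + β) * t))) := by
      intro q hq
      by_cases hq0 : q = 0
      · simp [hq0]
      · exact (hno q hq hq0).mono fun t ht h' => by
          obtain ⟨p, hp⟩ := h'.2
          exact absurd hp (not_le.2 (ht p))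
    refine key (((Filter.eventually_all_finite hSfin).2 hall).mono ?_)
    rintro t ht ⟨q, hq, h'⟩
    exact ht q hq h'
  refine absurd hSfin ?_
  have hinj : Function.Injective fun N : ℕ => ((N : ℤ) + 1) • q := by
    intro N M hNM
    obtain ⟨i, hi⟩ := Function.ne_iff.1 hq0
    have := congrFun hNM i
    simp only [Pi.smul_apply, smul_eq_mul] at this
    have := mul_right_cancel₀ hi this
    omega
  refine (Set.infinite_range_of_injective hinj).mono ?_
  rintro _ ⟨N, rfl⟩
  set Q := ‖(fun i => (q i : ℝ) : Fin n → ℝ)‖ with hQ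
  have hQ1 : 1 ≤ Q := one_le_norm_intCast hq0
  have hN0 : (0 : ℝ) < (N : ℝ) + 1 := by positivity
  have hnorm : ‖(fun i => ((((N : ℤ) + 1) • q) i : ℝ) : Fin n → ℝ)‖ = (N + 1) * Q := by
    have : (fun i => (((((N : ℤ) + 1) • q) i : ℤ) : ℝ)) = ((N : ℝ) + 1) • fun i => (q i : ℝ) := by
      funext i; simp
    rw [this, norm_smul, Real.norm_eq_abs, abs_of_pos hN0]
  have hlim : ∀ᶠ t : ℕ in Filter.atTop,
      ((N : ℝ) + 1) * (2 : ℝ) ^ (-((n + β) * t)) ≤ ((N + 1) * Q) ^ (-(n + β)) := by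
    have h1 : Filter.Tendsto (fun t : ℕ => ((N : ℝ) + 1) * (2 : ℝ) ^ (-((n + β) * t)))
        Filter.atTop (nhds (((N : ℝ) + 1) * 0)) := by
      refine Filter.Tendsto.const_mul _ ?_
      have : ∀ t : ℕ, (2 : ℝ) ^ (-((n + β) * t)) = ((2 : ℝ) ^ (-(n + β))) ^ t := by
        intro t
        rw [← Real.rpow_natCast, ← Real.rpow_mul (by norm_num)]
        congr 1; ring
      simp only [this]
      exact tendsto_pow_atTop_nhds_zero_of_lt_one (by positivity)
        (Real.rpow_lt_one_of_one_lt_of_neg (by norm_num) (by linarith))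
    rw [mul_zero] at h1
    exact h1.eventually (Iic_mem_nhds (by positivity))
  obtain ⟨t, ⟨p, hp⟩, ht⟩ := (hq.and_eventually hlim).exists
  refine ⟨(N + 1) * p, ?_⟩
  rw [hnorm]
  refine le_trans ?_ ht
  have : (∑ i, y i * (((((N : ℤ) + 1) • q) i : ℤ) : ℝ)) + (((N + 1) * p : ℤ) : ℝ) =
      ((N : ℝ) + 1) * ((∑ i, y i * (q i : ℝ)) + (p : ℝ)) := by
    rw [mul_add, Finset.mul_sum]
    congr 1
    · exact Finset.sum_congr rfl fun i _ => by simp; ring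
    · push_cast; ring
  rw [this, abs_mul, abs_of_pos hN0]
  exact mul_le_mul_of_nonneg_left hp hN0.le

end Diophantine

section Curves

open Matrix

variable {n : ℕ}

/-- Quantitative nondivergence of the lattices `ℤ^(n+1) * flowMatrix R (f x)`. -/
theorem volume_exists_norm_vecMul_lt_le {N : ℕ} {τ : ℝ} (hτ : 1 < τ)
    (hN : IsEmpty (Besicovitch.SatelliteConfig ℝ N τ)) {f : ℝ → Fin n → ℝ} {a b : ℝ} (hab : a < b)
    (hf : ContinuousOn f (Set.Icc a b)) {K : ℝ} (hK : 0 ≤ K) {p : ℕ} (hp : p ≠ 0)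
    (hgood : ∀ (c₀ : ℝ) (c : (Fin n → ℝ) →L[ℝ] ℝ) (a' b' : ℝ), a ≤ a' → b' ≤ b →
      ∀ x ∈ Set.Icc a' b', ∀ ε, 0 < ε →
        |c₀ + c (f x)| * volume.real {y ∈ Set.Icc a' b' | |c₀ + c (f y)| < ε} ^ p ≤
          K * ε * (b' - a') ^ p)
    {R ρ ε : ℝ} (hR : R ≠ 0) (hε : 0 < ε) (hερ : ε ≤ ρ) (hρ : ρ ≤ 1)
    (hsup : ∀ V : RatSubspace (n + 1), ∃ x ∈ Set.Icc a b, ρ ≤ V.height (flowMatrix R (f x))) :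
    volume {x ∈ Set.Icc a b | ∃ v : Fin (n + 1) → ℤ, v ≠ 0 ∧
        (n + 1) * ‖(fun i => (v i : ℝ)) ᵥ* flowMatrix R (f x)‖ < ε} ≤
      nondivConst N (n + 1) * ENNReal.ofReal ((K * ε / ρ) ^ (1 / p : ℝ)) *
        volume (Set.Icc a b) := by
  have hρ0 : 0 < ρ := hε.trans_le hερ
  have hcont : ∀ V : RatSubspace (n + 1),
      ContinuousOn (fun x => V.height (flowMatrix R (f x))) (Set.Icc a b) := by
    intro V
    refine ContinuousOn.norm (continuousOn_pi.2 fun σ => ?_)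
    obtain ⟨c₀, c, hc⟩ := exists_minors_mul_flowMatrix_eq (intRows V.basis) R σ
    simp only [hc]
    exact continuousOn_const.add (c.continuous.comp_continuousOn hf)
  have hmain := volume_not_marked_le hτ hN
    (fun (V : RatSubspace (n + 1)) x => V.height (flowMatrix R (f x))) (ρ := ρ) (ε := ε)
    (κ := ENNReal.ofReal ((K * ε / ρ) ^ (1 / p : ℝ))) (n + 1) {V | V.1 ≠ ⊥} a b hab
    (fun F hF hc => RatSubspace.card_le_of_isChain hc fun V hV => hF hV)
    (fun V _ => hcont V) (fun V _ => hsup V)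
    (fun x _ => (RatSubspace.finite_height_lt (isUnit_det_flowMatrix hR (f x)) ρ).subset
      fun V hV => hV.2) ?_
  · refine le_trans (measure_mono ?_) hmain
    rintro x ⟨hx, v, hv, hlt⟩
    refine ⟨hx, fun hm => ?_⟩
    have := le_norm_vecMul_of_marked hερ hρ hm hv
    push_cast at this
    exact absurd this (not_le.2 hlt)
  · rintro V - a' b' ha' hab' hb' ⟨x, hx, hρx⟩
    obtain ⟨σ, hσ⟩ : ∃ σ, ρ ≤ |minors (intRows V.basis * flowMatrix R (f x)) σ| := by
      by_contra hcon
      push Not at hcon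
      exact absurd hρx (not_le.2 ((pi_norm_lt_iff hρ0).2 hcon))
    obtain ⟨c₀, c, hc⟩ := exists_minors_mul_flowMatrix_eq (intRows V.basis) R σ
    rw [hc] at hσ
    have hsub : {y ∈ Set.Icc a' b' | V.height (flowMatrix R (f y)) < ε} ⊆
        {y ∈ Set.Icc a' b' | |c₀ + c (f y)| < ε} := by
      rintro y ⟨hy, hlt⟩
      refine ⟨hy, ?_⟩
      rw [← hc]
      exact (norm_le_pi_norm (minors (intRows V.basis * flowMatrix R (f y))) σ).trans_lt hlt
    refine (measure_mono hsub).trans ?_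
    set E := {y ∈ Set.Icc a' b' | |c₀ + c (f y)| < ε} with hE
    have hEfin : volume E ≠ ⊤ := ne_top_of_le_ne_top (by simp) (measure_mono fun y hy => hy.1)
    have h1 := hgood c₀ c a' b' ha' hb' x hx ε hε
    rw [← hE] at h1
    have hB : 0 < b' - a' := sub_pos.2 hab'
    have h2 : volume.real E ^ p ≤ (K * ε / ρ) * (b' - a') ^ p := by
      have h3 := (mul_le_mul_of_nonneg_right hσ
        (pow_nonneg (measureReal_nonneg (μ := volume) (s := E)) p)).trans h1
      rw [div_mul_eq_mul_div, le_div_iff₀ hρ0]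
      linarith
    have h4 : volume.real E ≤ (K * ε / ρ) ^ (1 / p : ℝ) * (b' - a') := by
      have hq : 0 ≤ K * ε / ρ := by positivity
      refine le_of_pow_le_pow_left₀ hp (by positivity) (h2.trans (le_of_eq ?_))
      rw [mul_pow, ← Real.rpow_natCast ((K * ε / ρ) ^ (1 / p : ℝ)), ← Real.rpow_mul hq,
        one_div_mul_cancel (by exact_mod_cast hp), Real.rpow_one]
    rw [Real.volume_Icc, ← ENNReal.ofReal_mul (by positivity), ← ofReal_measureReal hEfin]
    exact ENNReal.ofReal_le_ofReal h4

/-- An affine functional at a point of the affine span of a set is controlled by its values on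
the set. -/
theorem exists_forall_abs_le_of_mem_affineSpan {E : Type*} [NormedAddCommGroup E]
    [NormedSpace ℝ E] {S : Set E} {y₀ : E} (h : y₀ ∈ affineSpan ℝ S) :
    ∃ C : ℝ, 1 ≤ C ∧ ∀ (c₀ : ℝ) (c : E →L[ℝ] ℝ), ∃ x ∈ S, |c₀ + c y₀| ≤ C * |c₀ + c x| := by
  have hne : S.Nonempty := (affineSpan_nonempty ℝ).1 ⟨y₀, h⟩
  rw [← Subtype.range_coe (s := S)] at h
  obtain ⟨s, w, hw, hy⟩ := eq_affineCombination_of_mem_affineSpan h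
  rw [Finset.affineCombination_eq_linear_combination _ _ _ hw] at hy
  refine ⟨∑ i ∈ s, |w i| + 1, by linarith [Finset.sum_nonneg fun i (_ : i ∈ s) => abs_nonneg (w i)],
    fun c₀ c => ?_⟩
  by_contra hcon
  push Not at hcon
  set C := ∑ i ∈ s, |w i| with hC
  have hC0 : 0 ≤ C := Finset.sum_nonneg fun i _ => abs_nonneg (w i)
  have h1 : c₀ + c y₀ = ∑ i ∈ s, w i * (c₀ + c i) := by
    simp only [mul_add, Finset.sum_add_distrib, ← Finset.sum_mul, hw, one_mul]
    rw [hy, map_sum]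
    simp
  have h2 : |c₀ + c y₀| ≤ ∑ i ∈ s, |w i| * (|c₀ + c y₀| / (C + 1)) := by
    conv_lhs => rw [h1]
    refine (Finset.abs_sum_le_sum_abs _ _).trans (Finset.sum_le_sum fun i _ => ?_)
    rw [abs_mul]
    refine mul_le_mul_of_nonneg_left ?_ (abs_nonneg _)
    rw [le_div_iff₀ (by linarith), mul_comm]
    exact (hcon i i.2).le
  rw [← Finset.sum_mul, ← hC, ← mul_div_assoc, le_div_iff₀ (by linarith)] at h2
  obtain ⟨x, hx⟩ := hne
  have h3 : 0 < |c₀ + c y₀| :=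
    lt_of_le_of_lt (mul_nonneg (by linarith) (abs_nonneg _)) (hcon x hx)
  nlinarith

theorem volume_frequently_norm_le_eq_zero {f : ℝ → Fin n → ℝ} {a b : ℝ} (hab : a < b)
    (hf : ContinuousOn f (Set.Icc a b)) {K : ℝ} (hK : 0 ≤ K) {p : ℕ} (hp : p ≠ 0)
    (hgood : ∀ (c₀ : ℝ) (c : (Fin n → ℝ) →L[ℝ] ℝ) (a' b' : ℝ), a ≤ a' → b' ≤ b →
      ∀ x ∈ Set.Icc a' b', ∀ ε, 0 < ε →
        |c₀ + c (f x)| * volume.real {y ∈ Set.Icc a' b' | |c₀ + c (f y)| < ε} ^ p ≤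
          K * ε * (b' - a') ^ p)
    {y₀ : Fin n → ℝ} (hy₀ : y₀ ∈ affineSpan ℝ (f '' Set.Icc a b)) (hnot : ¬ IsVWA y₀)
    {γ : ℝ} (hγ : 0 < γ) :
    volume {x ∈ Set.Icc a b | ∃ᶠ t : ℕ in Filter.atTop, ∃ v : Fin (n + 1) → ℤ, v ≠ 0 ∧
      ‖(fun i => (v i : ℝ)) ᵥ* flowMatrix (2 ^ t) (f x)‖ ≤ (2 : ℝ) ^ (-(γ * t))} = 0 := by
  obtain ⟨N, τ, hτ, hN⟩ := HasBesicovitchCovering.no_satelliteConfig (α := ℝ)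
  obtain ⟨C, hC1, hC⟩ := exists_forall_abs_le_of_mem_affineSpan hy₀
  set k : ℝ := n + 1 with hk
  have hk1 : 1 ≤ k := by rw [hk]; linarith [(Nat.cast_nonneg n : (0 : ℝ) ≤ n)]
  have hk0 : 0 < k := by linarith
  set β := γ / (2 * k) with hβ
  have hβ0 : 0 < β := by positivity
  set A := k ^ (n + 1) * C with hA
  have hA1 : 1 ≤ A := one_le_mul_of_one_le_of_one_le (one_le_pow₀ hk1) hC1
  have hA0 : 0 < A := by linarith
  have hρform : ∀ t : ℕ, ((2 : ℝ) ^ (-(β * t))) ^ (n + 1) = (2 : ℝ) ^ (-(γ / 2 * t)) := by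
    intro t
    rw [← Real.rpow_natCast, ← Real.rpow_mul (by norm_num)]
    congr 1
    rw [hβ]
    push_cast
    rw [← hk]
    field_simp
  have hsmall : ∀ᶠ t : ℕ in Filter.atTop, 2 * k * A * (2 : ℝ) ^ (-(γ / 2 * t)) ≤ 1 := by
    have h1 : Filter.Tendsto (fun t : ℕ => 2 * k * A * (2 : ℝ) ^ (-(γ / 2 * t)))
        Filter.atTop (nhds (2 * k * A * 0)) := by
      refine Filter.Tendsto.const_mul _ ?_
      have : ∀ t : ℕ, (2 : ℝ) ^ (-(γ / 2 * t)) = ((2 : ℝ) ^ (-(γ / 2))) ^ t := by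
        intro t
        rw [← Real.rpow_natCast, ← Real.rpow_mul (by norm_num)]
        congr 1; ring
      simp only [this]
      exact tendsto_pow_atTop_nhds_zero_of_lt_one (by positivity)
        (Real.rpow_lt_one_of_one_lt_of_neg (by norm_num) (by linarith))
    rw [mul_zero] at h1
    exact h1.eventually (Iic_mem_nhds zero_lt_one)
  obtain ⟨t₁, ht₁⟩ := Filter.eventually_atTop.1
    ((eventually_le_norm_of_not_isVWA hnot hβ0).and hsmall)
  set θ : ℝ := (2 : ℝ) ^ (-(γ / 2) * (1 / p : ℝ)) with hθ
  have hp0 : (0 : ℝ) < p := by exact_mod_cast Nat.pos_of_ne_zero hp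
  have hθ1 : θ < 1 := by
    refine Real.rpow_lt_one_of_one_lt_of_neg (by norm_num) ?_
    have : 0 < γ / 2 * (1 / p : ℝ) := by positivity
    linarith
  have hθ0 : 0 ≤ θ := by positivity
  set M : ℝ := nondivConst N (n + 1) * (K * (2 * k * A)) ^ (1 / p : ℝ) * (b - a) with hM
  have hM0 : 0 ≤ M := by
    have := sub_pos.2 hab
    positivity
  have hbound : ∀ t : ℕ, volume {x | t₁ ≤ t ∧ x ∈ Set.Icc a b ∧ ∃ v : Fin (n + 1) → ℤ, v ≠ 0 ∧
      ‖(fun i => (v i : ℝ)) ᵥ* flowMatrix (2 ^ t) (f x)‖ ≤ (2 : ℝ) ^ (-(γ * t))} ≤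
      ENNReal.ofReal (M * θ ^ t) := by
    intro t
    by_cases ht : t₁ ≤ t
    swap
    · simp [ht]
    obtain ⟨hlow, hsm⟩ := ht₁ t ht
    set u : ℝ := (2 : ℝ) ^ (-(γ / 2 * t)) with hu
    have hu0 : 0 < u := by positivity
    have huu : (2 : ℝ) ^ (-(γ * t)) = u * u := by
      rw [hu, ← Real.rpow_add (by norm_num)]; congr 1; ring
    have hu1 : u ≤ 1 := Real.rpow_le_one_of_one_le_of_nonpos (by norm_num) (by
      have : 0 ≤ γ / 2 * t := by positivity
      linarith)
    have hmain := volume_exists_norm_vecMul_lt_le hτ hN hab hf hK hp hgood (R := 2 ^ t)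
      (ρ := u / A) (ε := 2 * k * (u * u)) (by positivity) (by positivity) ?_ ?_ ?_
    · refine (measure_mono ?_).trans (hmain.trans (le_of_eq ?_))
      · rintro x ⟨-, hx, v, hv, hle⟩
        refine ⟨hx, v, hv, ?_⟩
        rw [huu] at hle
        have h1 : k * ‖(fun i => (v i : ℝ)) ᵥ* flowMatrix (2 ^ t) (f x)‖ ≤ k * (u * u) :=
          mul_le_mul_of_nonneg_left hle hk0.le
        have h2 : 0 < k * (u * u) := by positivity
        rw [← hk]
        linarith
      · have h3 : K * (2 * k * (u * u)) / (u / A) = (K * (2 * k * A)) * u := by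
          field_simp
        have h4 : ((K * (2 * k * A)) * u) ^ (1 / p : ℝ) =
            (K * (2 * k * A)) ^ (1 / p : ℝ) * θ ^ t := by
          rw [Real.mul_rpow (by positivity) hu0.le, hu, hθ, ← Real.rpow_mul (by norm_num),
            ← Real.rpow_natCast, ← Real.rpow_mul (by norm_num)]
          congr 2
          ring
        rw [h3, h4, Real.volume_Icc, ← ENNReal.ofReal_natCast,
          ← ENNReal.ofReal_mul (by positivity), ← ENNReal.ofReal_mul (by positivity), hM]
        congr 1
        ring
    · rw [le_div_iff₀ hA0]
      calc 2 * k * (u * u) * A = (2 * k * A * u) * u := by ring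
        _ ≤ 1 * u := mul_le_mul_of_nonneg_right hsm hu0.le
        _ = u := one_mul u
    · rw [div_le_one hA0]
      exact hu1.trans hA1
    · intro V
      have h5 := V.le_height (isUnit_det_flowMatrix (R := 2 ^ t) (by positivity) y₀)
        (δ := (2 : ℝ) ^ (-(β * t))) (by positivity)
        (Real.rpow_le_one_of_one_le_of_nonpos (by norm_num) (by
          have : 0 ≤ β * t := by positivity
          linarith)) hlow
      rw [hρform, ← hu] at h5
      push_cast at h5
      rw [← hk] at h5
      have h6 : u / k ^ (n + 1) ≤ V.height (flowMatrix (2 ^ t) y₀) := by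
        rw [div_le_iff₀ (by positivity)]
        linarith
      obtain ⟨σ, hσ⟩ : ∃ σ, u / k ^ (n + 1) ≤
          |minors (intRows V.basis * flowMatrix (2 ^ t) y₀) σ| := by
        by_contra hcon
        push Not at hcon
        exact absurd h6 (not_le.2 ((pi_norm_lt_iff (by positivity)).2 hcon))
      obtain ⟨c₀, c, hc⟩ := exists_minors_mul_flowMatrix_eq (intRows V.basis) (2 ^ t) σ
      rw [hc] at hσ
      obtain ⟨_, ⟨x, hx, rfl⟩, hxC⟩ := hC c₀ c
      refine ⟨x, hx, ?_⟩
      refine le_trans ?_ (norm_le_pi_norm (minors (intRows V.basis * flowMatrix (2 ^ t) (f x))) σ)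
      rw [hc, Real.norm_eq_abs, hA, ← div_div, div_le_iff₀ (by linarith), mul_comm]
      exact hσ.trans hxC
  have hsum : ∑' t : ℕ, volume {x | t₁ ≤ t ∧ x ∈ Set.Icc a b ∧ ∃ v : Fin (n + 1) → ℤ, v ≠ 0 ∧
      ‖(fun i => (v i : ℝ)) ᵥ* flowMatrix (2 ^ t) (f x)‖ ≤ (2 : ℝ) ^ (-(γ * t))} ≠ ⊤ := by
    refine ne_top_of_le_ne_top ?_ (ENNReal.tsum_le_tsum hbound)
    exact ((summable_geometric_of_lt_one hθ0 hθ1).mul_left M).tsum_ofReal_ne_top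
  refine measure_mono_null ?_ (measure_setOfPred_frequently_eq_zero hsum)
  rintro x ⟨hx, hfreq⟩
  exact (hfreq.and_eventually (Filter.eventually_ge_atTop t₁)).mono fun t ht => ⟨ht.2, hx, ht.1⟩

end Curves

theorem deriv_mem_of_sub_mem {E : Type*} [NormedAddCommGroup E] [NormedSpace ℝ E]
    [FiniteDimensional ℝ E] {D : ℕ → ℝ → E} {a b : ℝ} (hab : a < b)
    (hD : ∀ k, ∀ x ∈ Set.Icc a b, HasDerivAt (D k) (D (k + 1) x) x) {W : Submodule ℝ E} {p : E}
    (hp : ∀ x ∈ Set.Icc a b, D 0 x - p ∈ W) : ∀ k, ∀ x ∈ Set.Icc a b, D (k + 1) x ∈ W := by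
  have key : ∀ (g : ℝ → E) (g' : ℝ → E), (∀ x ∈ Set.Icc a b, HasDerivAt g (g' x) x) →
      (∀ x ∈ Set.Icc a b, g x ∈ W) → ∀ x ∈ Set.Icc a b, g' x ∈ W := by
    intro g g' hg hW x hx
    have h1 := range_derivWithin_subset_closure_span_image g (s := Set.Icc a b) (t := Set.Icc a b)
      (by rw [Set.inter_self]; exact subset_closure) ⟨x, rfl⟩
    rw [(hg x hx).hasDerivWithinAt.derivWithin (uniqueDiffOn_Icc hab x hx)] at h1
    have h2 : Submodule.span ℝ (g '' Set.Icc a b) ≤ W := by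
      rw [Submodule.span_le]
      rintro _ ⟨y, hy, rfl⟩
      exact hW y hy
    exact closure_minimal (t := (W : Set E)) h2 W.closed_of_finiteDimensional h1
  intro k
  induction k with
  | zero => exact key (fun x => D 0 x - p) _ (fun x hx => (hD 0 x hx).sub_const p) hp
  | succ k ih => exact key _ _ (hD (k + 1)) ih

open Matrix in
/-- A curve which is nondegenerate at `t₀` in an affine subspace containing a point that is not
very well approximable is extremal near `t₀`. -/
theorem exists_volume_isVWA_curve_eq_zero {n : ℕ} {L : AffineSubspace ℝ (Fin n → ℝ)}
    {D : ℕ → ℝ → Fin n → ℝ} {t₀ δ₀ : ℝ} (hδ₀ : 0 < δ₀)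
    (hD : ∀ k, ∀ x ∈ Set.Icc (t₀ - δ₀) (t₀ + δ₀), HasDerivAt (D k) (D (k + 1) x) x)
    (hL : ∀ x ∈ Set.Icc (t₀ - δ₀) (t₀ + δ₀), D 0 x ∈ L) {l : ℕ}
    (hspan : L.direction ≤ Submodule.span ℝ (Set.range fun i : Fin l => D (i + 1) t₀))
    {y₀ : Fin n → ℝ} (hy₀ : y₀ ∈ L) (hnot : ¬ IsVWA y₀) :
    ∃ δ, 0 < δ ∧ volume {t ∈ Set.Icc (t₀ - δ) (t₀ + δ) | IsVWA (D 0 t)} = 0 := by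
  have hmem := deriv_mem_of_sub_mem (by linarith) hD (W := L.direction) (p := y₀)
    fun x hx => AffineSubspace.vsub_mem_direction (hL x hx) hy₀
  obtain ⟨δ, hδ0, hδ, K, hK, hgood⟩ := exists_uniformly_good hδ₀ hD fun k x hx =>
    hspan (hmem k x hx)
  refine ⟨δ, hδ0, ?_⟩
  have hsub : Set.Icc (t₀ - δ) (t₀ + δ) ⊆ Set.Icc (t₀ - δ₀) (t₀ + δ₀) :=
    Set.Icc_subset_Icc (by linarith) (by linarith)
  have ht₀ : t₀ ∈ Set.Icc (t₀ - δ) (t₀ + δ) := ⟨by linarith, by linarith⟩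
  set S := D 0 '' Set.Icc (t₀ - δ) (t₀ + δ) with hS
  have hmem' := deriv_mem_of_sub_mem (a := t₀ - δ) (b := t₀ + δ) (by linarith)
    (fun k x hx => hD k x (hsub hx)) (W := vectorSpan ℝ S) (p := D 0 t₀)
    fun x hx => vsub_mem_vectorSpan ℝ (Set.mem_image_of_mem _ hx) (Set.mem_image_of_mem _ ht₀)
  have hdir : L.direction ≤ vectorSpan ℝ S := by
    refine hspan.trans (Submodule.span_le.2 ?_)
    rintro _ ⟨i, rfl⟩
    exact hmem' i t₀ ht₀
  have hyS : y₀ ∈ affineSpan ℝ S := by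
    have h1 : y₀ -ᵥ D 0 t₀ ∈ vectorSpan ℝ S :=
      hdir (AffineSubspace.vsub_mem_direction hy₀ (hL t₀ (hsub ht₀)))
    rw [← direction_affineSpan] at h1
    have h2 := AffineSubspace.vadd_mem_of_mem_direction h1
      (subset_affineSpan ℝ S (Set.mem_image_of_mem (D 0) ht₀))
    simpa using h2
  have hnull : ∀ m : ℕ, volume {x ∈ Set.Icc (t₀ - δ) (t₀ + δ) |
      ∃ᶠ t : ℕ in Filter.atTop, ∃ v : Fin (n + 1) → ℤ, v ≠ 0 ∧
      ‖(fun i => (v i : ℝ)) ᵥ* flowMatrix (2 ^ t) (D 0 x)‖ ≤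
        (2 : ℝ) ^ (-((1 / ((m : ℝ) + 1)) * t))} = 0 := fun m =>
    volume_frequently_norm_le_eq_zero (by linarith)
      (fun x hx => (hD 0 x (hsub hx)).continuousAt.continuousWithinAt) hK (Nat.succ_ne_zero l)
      hgood hyS hnot (by positivity)
  refine measure_mono_null ?_ (measure_iUnion_null hnull)
  rintro x ⟨hx, hvwa⟩
  obtain ⟨γ, hγ, hfreq⟩ := hvwa.exists_frequently_norm_le
  obtain ⟨m, hm⟩ := exists_nat_one_div_lt hγ
  rw [Set.mem_iUnion]
  refine ⟨m, hx, hfreq.mono ?_⟩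
  rintro t ⟨v, hv, hle⟩
  refine ⟨v, hv, hle.trans ?_⟩
  apply Real.rpow_le_rpow_of_exponent_le (by norm_num)
  rw [neg_le_neg_iff]
  exact mul_le_mul_of_nonneg_right hm.le (Nat.cast_nonneg t)

theorem iteratedFDeriv_comp_perm_of_contDiffAt {E F : Type*} [NormedAddCommGroup E]
    [NormedSpace ℝ E] [NormedAddCommGroup F] [NormedSpace ℝ F] {f : E → F} (n : ℕ) :
    ∀ {x : E}, ContDiffAt ℝ n f x → ∀ (σ : Equiv.Perm (Fin n)) (v : Fin n → E),
      iteratedFDeriv ℝ n f x (v ∘ σ) = iteratedFDeriv ℝ n f x v := by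
  induction n with
  | zero => intro x _ σ v; rw [Subsingleton.elim (v ∘ σ) v]
  | succ n ih =>
    intro x hf σ
    have hσ : σ ∈ Submonoid.closure
        (Set.range fun i : Fin n => Equiv.swap i.castSucc i.succ) := by
      rw [Equiv.Perm.mclosure_swap_castSucc_succ]; trivial
    induction hσ using Submonoid.closure_induction with
    | one => intro v; rfl
    | mul σ τ _ _ h1 h2 =>
      intro v
      rw [Equiv.Perm.coe_mul, ← Function.comp_assoc, h2, h1]
    | mem τ hτ =>
      obtain ⟨i, rfl⟩ := hτ
      intro v
      have hdiff : DifferentiableAt ℝ (iteratedFDeriv ℝ n f) x :=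
        hf.differentiableAt_iteratedFDeriv (by exact_mod_cast Nat.lt_succ_self n)
      rcases n with _ | n
      · exact i.elim0
      refine Fin.cases ?_ (fun j => ?_) i
      · have hg : ContDiffAt ℝ 2 (iteratedFDeriv ℝ n f) x :=
          hf.iteratedFDeriv_right (by norm_cast; omega)
        have hsymm := hg.isSymmSndFDerivAt (by simp)
        have hfd : DifferentiableAt ℝ (fderiv ℝ (iteratedFDeriv ℝ n f)) x :=
          (hg.fderiv_right (m := 1) (by norm_num)).differentiableAt (by norm_num)
        have key : ∀ w : Fin (n + 2) → E, iteratedFDeriv ℝ (n + 2) f x w =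
            fderiv ℝ (fderiv ℝ (iteratedFDeriv ℝ n f)) x (w 0) (w 1) (Fin.tail (Fin.tail w)) := by
          intro w
          rw [hdiff.iteratedFDeriv_succ_apply_left']
          simp only [iteratedFDeriv_succ_apply_left]
          have h0 : HasFDerivAt (fun y => fderiv ℝ (iteratedFDeriv ℝ n f) y (w 1)) _ x :=
            hfd.hasFDerivAt.clm_apply (hasFDerivAt_const (w 1) x)
          have h1 : HasFDerivAt (fun y => (fderiv ℝ (iteratedFDeriv ℝ n f) y (w 1))
              (Fin.tail (Fin.tail w))) _ x :=
            ((ContinuousMultilinearMap.apply ℝ (fun _ : Fin n => E) F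
              (Fin.tail (Fin.tail w))).hasFDerivAt).comp x h0
          refine (congrArg (fun L => L (w 0)) h1.fderiv).trans ?_
          simp
        rw [key, key]
        have e0 : (v ∘ Equiv.swap (0 : Fin (n + 1)).castSucc (0 : Fin (n + 1)).succ) 0 = v 1 := by
          simp
        have e1 : (v ∘ Equiv.swap (0 : Fin (n + 1)).castSucc (0 : Fin (n + 1)).succ) 1 = v 0 := by
          simp
        have e2 : Fin.tail (Fin.tail
            (v ∘ Equiv.swap (0 : Fin (n + 1)).castSucc (0 : Fin (n + 1)).succ)) =
            Fin.tail (Fin.tail v) := by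
          funext k
          simp only [Fin.tail, Function.comp]
          rw [Equiv.swap_apply_of_ne_of_ne]
          · simp [Fin.ext_iff]
          · simp [Fin.ext_iff]
        rw [e0, e1, e2, hsymm.eq]
      · rw [hdiff.iteratedFDeriv_succ_apply_left', hdiff.iteratedFDeriv_succ_apply_left']
        have e0 : (v ∘ Equiv.swap j.succ.castSucc j.succ.succ) 0 = v 0 := by
          simp only [Function.comp]
          rw [Equiv.swap_apply_of_ne_of_ne]
          · simp [Fin.ext_iff]
          · simp [Fin.ext_iff]
        have e1 : Fin.tail (v ∘ Equiv.swap j.succ.castSucc j.succ.succ) =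
            Fin.tail v ∘ Equiv.swap j.castSucc j.succ := by
          funext k
          simp only [Fin.tail, Function.comp]
          congr 1
          rw [← Fin.succ_castSucc]
          exact (Fin.succ_injective _).swap_apply _ _ _
        rw [e0, e1]
        congr 1
        apply Filter.EventuallyEq.fderiv_eq
        have hev : ∀ᶠ y in nhds x, ContDiffAt ℝ (n + 1 : ℕ) f y :=
          (hf.of_le (by norm_cast; omega)).eventually (by simp)
        filter_upwards [hev] with y hy
        exact ih hy _ _

/-- Polarization: an iterated derivative vanishing on the diagonal vanishes. -/
theorem iteratedFDeriv_eq_zero_of_diag {E F : Type*} [NormedAddCommGroup E]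
    [NormedSpace ℝ E] [NormedAddCommGroup F] [NormedSpace ℝ F] {f : E → F} {n : ℕ} {x : E}
    (hf : ContDiffAt ℝ n f x) (h : ∀ u : E, iteratedFDeriv ℝ n f x (fun _ => u) = 0)
    (v : Fin n → E) : iteratedFDeriv ℝ n f x v = 0 := by
  have h1 := ContinuousMultilinearMap.iteratedFDeriv_comp_diagonal (iteratedFDeriv ℝ n f x) 0 v
  have h2 : (fun u : E => iteratedFDeriv ℝ n f x fun _ => u) = fun _ => 0 := funext h
  have h3 : ∀ σ : Equiv.Perm (Fin n), iteratedFDeriv ℝ n f x (fun i => v (σ i)) =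
      iteratedFDeriv ℝ n f x v := fun σ => iteratedFDeriv_comp_perm_of_contDiffAt n hf σ v
  rw [h2, Finset.sum_congr rfl fun σ _ => h3 σ] at h1
  simp only [Finset.sum_const, Finset.card_univ, Fintype.card_perm, Fintype.card_fin,
    ← Nat.cast_smul_eq_nsmul ℝ] at h1
  have h4 : iteratedFDeriv ℝ n (fun _ : E => (0 : F)) 0 v = 0 := by
    simp
  rw [h4] at h1
  exact (smul_eq_zero.1 h1.symm).resolve_left 
    (Nat.cast_ne_zero.2 (Nat.factorial_ne_zero n))

theorem exists_taylor_bound {E F : Type*} [NormedAddCommGroup E] [NormedSpace ℝ E]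
    [NormedAddCommGroup F] [NormedSpace ℝ F] [CompleteSpace F] {f : E → F} {x : E} {n : ℕ}
    (hf : ContDiffAt ℝ (n + 1) f x) : ∃ C : ℝ, 0 ≤ C ∧ ∀ᶠ h in nhds (0 : E),
      ‖f (x + h) - ∑ k ∈ Finset.range (n + 1),
        ((k.factorial : ℝ)⁻¹ • iteratedFDeriv ℝ k f x fun _ => h)‖ ≤ C * ‖h‖ ^ (n + 1) := by
  have hcont : ContinuousAt (iteratedFDeriv ℝ (n + 1) f) x :=
    (hf.iteratedFDeriv_right (i := n + 1) (m := 0) (by simp)).continuousAt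
  set B := ‖iteratedFDeriv ℝ (n + 1) f x‖ + 1 with hB
  have hB0 : 0 ≤ B := by positivity
  have hev : ∀ᶠ y in nhds x, ContDiffAt ℝ (n + 1) f y ∧ ‖iteratedFDeriv ℝ (n + 1) f y‖ ≤ B :=
    (((show ContDiffAt ℝ (n + 1 : ℕ) f x by exact_mod_cast hf).eventually (by simp)).mono
      fun y hy => show ContDiffAt ℝ (n + 1) f y by exact_mod_cast hy).and
      ((hcont.norm.eventually_lt continuousAt_const (by simp [hB])).mono fun _ h => h.le)
  obtain ⟨r, hr, hball⟩ := Metric.eventually_nhds_iff_ball.1 hev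
  refine ⟨B, hB0, ?_⟩
  filter_upwards [Metric.ball_mem_nhds (0 : E) hr] with h hh
  rw [mem_ball_zero_iff] at hh
  have hseg : ∀ t ∈ Set.Icc (0 : ℝ) 1, x + t • h ∈ Metric.ball x r := by
    intro t ht
    rw [mem_ball_iff_norm, add_sub_cancel_left, norm_smul, Real.norm_of_nonneg ht.1]
    exact lt_of_le_of_lt (mul_le_of_le_one_left (norm_nonneg _) ht.2) hh
  rw [map_add_eq_sum_add_integral_iteratedFDeriv (n := n) fun t ht => (hball _ (hseg t ht)).1,
    add_sub_cancel_left, norm_smul]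
  have hbd : ‖∫ t in (0 : ℝ)..1, (1 - t) ^ n • iteratedFDeriv ℝ (n + 1) f (x + t • h) fun _ => h‖ ≤
      B * ‖h‖ ^ (n + 1) * |1 - 0| := by
    apply intervalIntegral.norm_integral_le_of_norm_le_const
    intro t ht
    rw [Set.uIoc_of_le zero_le_one] at ht
    have ht' : t ∈ Set.Icc (0 : ℝ) 1 := ⟨ht.1.le, ht.2⟩
    rw [norm_smul, norm_pow, Real.norm_of_nonneg (by linarith [ht.2])]
    have h1 : (1 - t) ^ n ≤ 1 := pow_le_one₀ (by linarith [ht.2]) (by linarith [ht.1])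
    have h2 := (iteratedFDeriv ℝ (n + 1) f (x + t • h)).le_opNorm fun _ => h
    simp only [Finset.prod_const, Finset.card_univ, Fintype.card_fin] at h2
    have h3 : ‖iteratedFDeriv ℝ (n + 1) f (x + t • h)‖ * ‖h‖ ^ (n + 1) ≤ B * ‖h‖ ^ (n + 1) :=
      mul_le_mul_of_nonneg_right (hball _ (hseg t ht')).2 (by positivity)
    exact (mul_le_of_le_one_left (norm_nonneg _) h1).trans (h2.trans h3)
  have hfac : ‖(n.factorial : ℝ)⁻¹‖ ≤ 1 := by
    rw [norm_inv, Real.norm_of_nonneg (Nat.cast_nonneg _)]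
    exact inv_le_one_of_one_le₀ (by exact_mod_cast n.factorial_pos)
  refine (mul_le_of_le_one_left (norm_nonneg _) hfac).trans (hbd.trans ?_)
  simp

open Polynomial in
theorem eq_zero_of_abs_eval_le {p : ℝ[X]} {N : ℕ} (hp : p.natDegree < N) {C : ℝ}
    (h : ∀ᶠ t in nhdsWithin (0 : ℝ) {0}ᶜ, |p.eval t| ≤ C * |t| ^ N) : p = 0 := by
  by_contra hne
  obtain ⟨q, hq, hndvd⟩ := exists_eq_pow_rootMultiplicity_mul_and_not_dvd p hne 0
  set k := p.rootMultiplicity 0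
  rw [C_0, sub_zero] at hq hndvd
  have hk : k < N := by
    refine lt_of_le_of_lt ?_ hp
    have hq0 : q ≠ 0 := by rintro rfl; exact hndvd (dvd_zero _)
    have := congrArg natDegree hq
    rw [natDegree_mul (pow_ne_zero _ X_ne_zero) hq0, natDegree_X_pow] at this
    omega
  have hq0 : q.eval 0 ≠ 0 := by
    rw [X_dvd_iff, coeff_zero_eq_eval_zero] at hndvd
    exact hndvd
  have hbound : ∀ᶠ t in nhdsWithin (0 : ℝ) {0}ᶜ, |q.eval t| ≤ C * |t| ^ (N - k) := by
    filter_upwards [h, self_mem_nhdsWithin] with t ht ht0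
    have ht0 : 0 < |t| := abs_pos.2 ht0
    rw [hq, eval_mul, eval_pow, eval_X, abs_mul, abs_pow,
      show N = k + (N - k) by omega, pow_add] at ht
    have : |t| ^ k * |q.eval t| ≤ |t| ^ k * (C * |t| ^ (N - k)) := by linarith
    exact le_of_mul_le_mul_left this (by positivity)
  have h1 : Filter.Tendsto (fun t : ℝ => |q.eval t|) (nhdsWithin (0 : ℝ) {0}ᶜ)
      (nhds |q.eval 0|) :=
    (q.continuous.abs.tendsto 0).mono_left nhdsWithin_le_nhds
  have h2 : Filter.Tendsto (fun t : ℝ => C * |t| ^ (N - k)) (nhdsWithin (0 : ℝ) {0}ᶜ)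
      (nhds 0) := by
    have : Continuous fun t : ℝ => C * |t| ^ (N - k) := by fun_prop
    have := (this.tendsto 0).mono_left (nhdsWithin_le_nhds (s := {0}ᶜ))
    simpa [show N - k ≠ 0 by omega] using this
  have h3 := le_of_tendsto_of_tendsto h1 h2 hbound
  exact hq0 (abs_eq_zero.1 (le_antisymm h3 (abs_nonneg _)))

open Polynomial in
theorem exists_polynomial_diag {E : Type*} [NormedAddCommGroup E] [NormedSpace ℝ E] {i r B : ℕ}
    (T : ContinuousMultilinearMap ℝ (fun _ : Fin i => E) ℝ) (b : Fin r → ℝ[X])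
    (hb : ∀ j, (b j).natDegree ≤ B) (u : Fin r → E) :
    ∃ Q : ℝ[X], Q.natDegree ≤ i * B ∧
      ∀ t, Q.eval t = T fun _ => ∑ j, (b j).eval t • u j := by
  refine ⟨∑ ρ : Fin i → Fin r, C (T fun a => u (ρ a)) * ∏ a, b (ρ a), ?_, fun t => ?_⟩
  · refine natDegree_sum_le_of_forall_le _ _ fun ρ _ => (natDegree_C_mul_le _ _).trans
      ((natDegree_prod_le _ _).trans ?_)
    refine (Finset.sum_le_card_nsmul _ _ B fun a _ => hb _).trans ?_
    simp
  · have h1 := T.toMultilinearMap.map_sum (fun (_ : Fin i) (j : Fin r) => (b j).eval t • u j)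
    simp only [ContinuousMultilinearMap.coe_coe] at h1
    rw [h1, eval_finsetSum]
    refine Finset.sum_congr rfl fun ρ _ => ?_
    have h2 := T.map_smul_univ (fun a => (b (ρ a)).eval t) fun a => u (ρ a)
    rw [h2, eval_mul, eval_C, eval_prod, smul_eq_mul, mul_comm]

theorem iteratedFDeriv_apply_const_smul {E : Type*} [NormedAddCommGroup E] [NormedSpace ℝ E]
    (g : E → ℝ) (x : E) (k : ℕ) (c : ℝ) (v : E) :
    (iteratedFDeriv ℝ k g x fun _ => c • v) = c ^ k * iteratedFDeriv ℝ k g x fun _ => v := by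
  have := (iteratedFDeriv ℝ k g x).map_smul_univ (fun _ => c) fun _ => v
  simpa using this

open Polynomial in
/-- A polynomial curve whose jet at `0` detects finitely many prescribed directional derivatives
of every smooth function. -/
theorem exists_polynomial_curve {E : Type*} [NormedAddCommGroup E] [NormedSpace ℝ E] (x₀ : E)
    (l : ℕ) {r : ℕ} (u : Fin r → E) :
    ∃ φ : ℝ → E, ContDiff ℝ (⊤ : ℕ∞) φ ∧ φ 0 = 0 ∧ ∃ N : ℕ, ∀ g : E → ℝ,
      ContDiffAt ℝ (⊤ : ℕ∞) g x₀ →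
      (∀ k, 1 ≤ k → k ≤ N →
        iteratedFDeriv ℝ k (fun p : E × ℝ => g (p.1 + φ p.2)) (x₀, 0) (fun _ => (0, 1)) = 0) →
      ∀ i, 1 ≤ i → i ≤ l → ∀ j, iteratedFDeriv ℝ i g x₀ (fun _ => u j) = 0 := by
  set b : Fin r → ℝ[X] := fun j => Lagrange.basis Finset.univ (fun j : Fin r => (j : ℝ)) j with hb
  have hinj : Set.InjOn (fun j : Fin r => (j : ℝ)) (Finset.univ : Finset (Fin r)) := by
    intro i _ j _ h
    exact Fin.ext (Nat.cast_injective (R := ℝ) h)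
  have hbdeg : ∀ j, (b j).natDegree ≤ r := by
    intro j
    rw [hb]
    simp only
    rw [natDegree_le_iff_degree_le, Lagrange.degree_basis hinj (Finset.mem_univ j)]
    exact_mod_cast (by simp : (Finset.univ : Finset (Fin r)).card - 1 ≤ r)
  set κ : ℝ → E := fun t => ∑ j, (b j).eval t • u j with hκ
  have hκ_node : ∀ j : Fin r, κ (j : ℝ) = u j := by
    intro j
    rw [hκ]
    simp only
    rw [Finset.sum_eq_single j]
    · rw [hb]
      simp only
      rw [Lagrange.eval_basis_self hinj (Finset.mem_univ j), one_smul]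
    · intro i _ hij
      rw [hb]
      simp only
      rw [Lagrange.eval_basis_of_ne (v := fun j : Fin r => (j : ℝ)) hij (Finset.mem_univ j),
        zero_smul]
    · simp
  have hb_smooth : ∀ j, ContDiff ℝ (⊤ : ℕ∞) fun t => (b j).eval t := fun j => by
    simpa [coe_aeval_eq_eval] using (b j).contDiff_aeval (𝕜 := ℝ) (⊤ : ℕ∞)
  have hκ_smooth : ContDiff ℝ (⊤ : ℕ∞) κ :=
    ContDiff.sum fun j _ => (hb_smooth j).smul contDiff_const
  set M := l * r + 1 with hM
  set φ : ℝ → E := fun t => t ^ M • κ t with hφ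
  have hφ_smooth : ContDiff ℝ (⊤ : ℕ∞) φ := (contDiff_id.pow M).smul hκ_smooth
  have hφ0 : φ 0 = 0 := by simp [hφ, hM]
  refine ⟨φ, hφ_smooth, hφ0, M * (l + 1), fun g hg hvan => ?_⟩
  set N := M * (l + 1) with hN
  set G : E × ℝ → ℝ := fun p => g (p.1 + φ p.2) with hG
  have hGs : ContDiffAt ℝ (⊤ : ℕ∞) G (x₀, 0) := by
    refine ContDiffAt.comp (x₀, (0 : ℝ)) (g := g) (f := fun p : E × ℝ => p.1 + φ p.2) ?_ ?_
    · simpa [hφ0] using hg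
    · exact (contDiff_fst.add (hφ_smooth.comp contDiff_snd)).contDiffAt
  obtain ⟨C, hC0, hC⟩ := exists_taylor_bound (n := N) (hGs.of_le (by exact_mod_cast le_top))
  have hcurve : ∀ᶠ t in nhds (0 : ℝ), |g (x₀ + φ t) - g x₀| ≤ C * |t| ^ (N + 1) := by
    have htend : Filter.Tendsto (fun t : ℝ => ((0 : E), t)) (nhds 0) (nhds 0) := by
      have : Continuous fun t : ℝ => ((0 : E), t) := by fun_prop
      exact this.tendsto 0
    filter_upwards [htend.eventually hC] with t ht
    have hterm : ∀ k ∈ Finset.range (N + 1), k ≠ 0 →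
        ((k.factorial : ℝ)⁻¹ • iteratedFDeriv ℝ k G (x₀, 0) fun _ => ((0 : E), t)) = 0 := by
      intro k hk hk0
      have e : ((0 : E), t) = t • ((0 : E), (1 : ℝ)) := by simp
      rw [e, iteratedFDeriv_apply_const_smul, hvan k (Nat.one_le_iff_ne_zero.2 hk0)
        (by simpa [Nat.lt_succ_iff] using hk)]
      simp
    rw [Finset.sum_eq_single_of_mem 0 (by simp) hterm] at ht
    simpa [hG, hφ0, Prod.norm_def] using ht
  have hκb : ∀ᶠ t in nhds (0 : ℝ), ‖κ t‖ ≤ ‖κ 0‖ + 1 :=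
    (hκ_smooth.continuous.norm.continuousAt.eventually_lt continuousAt_const
      (by simp)).mono fun _ h => h.le
  have main : ∀ i, 1 ≤ i → i ≤ l → ∀ t, iteratedFDeriv ℝ i g x₀ (fun _ => κ t) = 0 := by
    intro i
    induction i using Nat.strong_induction_on with
    | _ i ih =>
    intro hi1 hil
    obtain ⟨Q, hQdeg, hQ⟩ := exists_polynomial_diag (iteratedFDeriv ℝ i g x₀) b hbdeg u
    obtain ⟨C', hC'0, hC'⟩ := exists_taylor_bound (n := i) (hg.of_le (by exact_mod_cast le_top))
    have hφt : Filter.Tendsto φ (nhds 0) (nhds 0) := by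
      simpa [hφ0] using hφ_smooth.continuous.tendsto 0
    set K := ‖κ 0‖ + 1 with hK
    have hQ0 : Q = 0 := by
      refine eq_zero_of_abs_eval_le (N := M) (C := i.factorial * (C' * K ^ (i + 1) + C)) ?_ ?_
      · exact lt_of_le_of_lt (hQdeg.trans (Nat.mul_le_mul_right r hil)) (Nat.lt_succ_self _)
      filter_upwards [nhdsWithin_le_nhds (hφt.eventually hC'), nhdsWithin_le_nhds hcurve,
        nhdsWithin_le_nhds hκb, nhdsWithin_le_nhds (Metric.ball_mem_nhds (0 : ℝ) one_pos),
        self_mem_nhdsWithin] with t h1 h2 h3 h4 h5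
      have ht0 : 0 < |t| := abs_pos.2 h5
      have ht1 : |t| ≤ 1 := by simpa using (mem_ball_zero_iff.1 h4).le
      have hterm : ∀ k ∈ Finset.range i, k ≠ 0 →
          ((k.factorial : ℝ)⁻¹ • iteratedFDeriv ℝ k g x₀ fun _ => φ t) = 0 := by
        intro k hk hk0
        have hki : k < i := Finset.mem_range.1 hk
        rw [hφ]
        simp only
        rw [iteratedFDeriv_apply_const_smul, ih k hki (Nat.one_le_iff_ne_zero.2 hk0)
          (hki.le.trans hil)]
        simp
      rw [Finset.sum_range_succ, Finset.sum_eq_single_of_mem 0 (Finset.mem_range.2 hi1) hterm] at h1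
      have hlast : (iteratedFDeriv ℝ i g x₀ fun _ => φ t) =
          (t ^ M) ^ i * Q.eval t := by
        rw [hQ]
        exact iteratedFDeriv_apply_const_smul g x₀ i (t ^ M) (κ t)
      rw [hlast] at h1
      simp only [Nat.factorial_zero, Nat.cast_one, inv_one, iteratedFDeriv_zero_apply,
        Real.norm_eq_abs, smul_eq_mul, one_mul] at h1
      have hnorm : ‖φ t‖ ^ (i + 1) ≤ K ^ (i + 1) * |t| ^ (M * (i + 1)) := by
        rw [pow_mul, ← mul_pow]
        refine pow_le_pow_left₀ (norm_nonneg _) ?_ _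
        rw [hφ]
        simp only
        rw [norm_smul, norm_pow, Real.norm_eq_abs, mul_comm]
        exact mul_le_mul_of_nonneg_right h3 (by positivity)
      have hpow : |t| ^ (N + 1) ≤ |t| ^ (M * (i + 1)) := by
        refine pow_le_pow_of_le_one ht0.le ht1 ?_
        rw [hN]
        exact (Nat.mul_le_mul_left M (by omega)).trans (Nat.le_succ _)
      have hfac : (0 : ℝ) < i.factorial := by exact_mod_cast i.factorial_pos
      have h6 : |(i.factorial : ℝ)⁻¹ * ((t ^ M) ^ i * Q.eval t)| ≤
          (C' * K ^ (i + 1) + C) * |t| ^ (M * (i + 1)) := by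
        have e : (i.factorial : ℝ)⁻¹ * ((t ^ M) ^ i * Q.eval t) = (g (x₀ + φ t) - g x₀) -
            (g (x₀ + φ t) - (g x₀ + (i.factorial : ℝ)⁻¹ * ((t ^ M) ^ i * Q.eval t))) := by ring
        rw [e]
        refine (abs_sub _ _).trans ?_
        have h7 := h1.trans (mul_le_mul_of_nonneg_left hnorm hC'0)
        have h8 := h2.trans (mul_le_mul_of_nonneg_left hpow hC0)
        linarith
      rw [abs_mul, abs_mul, abs_inv, abs_of_pos hfac, inv_mul_le_iff₀ hfac, abs_pow, abs_pow,
        ← pow_mul, show |t| ^ (M * (i + 1)) = |t| ^ (M * i) * |t| ^ M by ring] at h6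
      have h9 : |t| ^ (M * i) * |Q.eval t| ≤
          |t| ^ (M * i) * (i.factorial * (C' * K ^ (i + 1) + C) * |t| ^ M) := by linarith
      exact le_of_mul_le_mul_left h9 (by positivity)
    intro t
    have := hQ t
    rw [hQ0, eval_zero] at this
    exact this.symm
  intro i hi1 hil j
  have := main i hi1 hil (j : ℝ)
  rwa [hκ_node] at this

theorem exists_curve_span {E F : Type*} [NormedAddCommGroup E] [NormedSpace ℝ E]
    [NormedAddCommGroup F] [NormedSpace ℝ F] [FiniteDimensional ℝ F] {f : E → F} {x₀ : E}
    (hf : ContDiffAt ℝ (⊤ : ℕ∞) f x₀) (l : ℕ) :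
    ∃ φ : ℝ → E, ContDiff ℝ (⊤ : ℕ∞) φ ∧ φ 0 = 0 ∧ ∃ N : ℕ,
      Submodule.span ℝ {y : F | ∃ m : ℕ, 1 ≤ m ∧ m ≤ l ∧
        ∃ u : Fin m → E, y = iteratedFDeriv ℝ m f x₀ u} ≤
      Submodule.span ℝ (Set.range fun i : Fin N =>
        iteratedFDeriv ℝ (i + 1) (fun p : E × ℝ => f (p.1 + φ p.2)) (x₀, 0)
          fun _ => ((0 : E), (1 : ℝ))) := by
  have hle : ∀ k : ℕ, (k : WithTop ℕ∞) ≤ ((⊤ : ℕ∞) : WithTop ℕ∞) :=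
    fun k => by exact_mod_cast le_top
  set S : Set F := {y | ∃ m : ℕ, 1 ≤ m ∧ m ≤ l ∧ ∃ u : E, y = iteratedFDeriv ℝ m f x₀ fun _ => u}
    with hS
  obtain ⟨b, hbS, hbspan, hbli⟩ := exists_linearIndependent ℝ S
  have hbfin : b.Finite := hbli.setFinite
  have hchoice : ∀ y : b, ∃ u : E, ∃ m : ℕ, 1 ≤ m ∧ m ≤ l ∧
      (y : F) = iteratedFDeriv ℝ m f x₀ fun _ => u := by
    intro y
    obtain ⟨m, h1, h2, u, h3⟩ := hbS y.2
    exact ⟨u, m, h1, h2, h3⟩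
  choose u hu using hchoice
  have : Finite b := hbfin
  obtain ⟨r, ⟨e⟩⟩ := Finite.exists_equiv_fin b
  obtain ⟨φ, hφ, hφ0, N, hN⟩ := exists_polynomial_curve x₀ l fun j => u (e.symm j)
  refine ⟨φ, hφ, hφ0, N, ?_⟩
  set G : E × ℝ → F := fun p => f (p.1 + φ p.2) with hG
  have hGs : ContDiffAt ℝ (⊤ : ℕ∞) G (x₀, 0) := by
    refine ContDiffAt.comp (x₀, (0 : ℝ)) (g := f) (f := fun p : E × ℝ => p.1 + φ p.2) ?_ ?_
    · simpa [hφ0] using hf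
    · exact (contDiff_fst.add (hφ.comp contDiff_snd)).contDiffAt
  intro y hy
  by_contra hcon
  obtain ⟨Λ, hΛy, hΛ⟩ := Submodule.exists_le_ker_of_notMem hcon
  set c : F →L[ℝ] ℝ := LinearMap.toContinuousLinearMap Λ with hc
  have hcomp : ∀ (k : ℕ) (v : Fin k → E),
      iteratedFDeriv ℝ k (c ∘ f) x₀ v = Λ (iteratedFDeriv ℝ k f x₀ v) := by
    intro k v
    rw [c.iteratedFDeriv_comp_left hf (hle k)]
    rfl
  have hcf : ContDiffAt ℝ (⊤ : ℕ∞) (c ∘ f) x₀ := c.contDiff.contDiffAt.comp x₀ hf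
  have hker := hN (c ∘ f) hcf (by
    intro k hk1 hkN
    have h1 : iteratedFDeriv ℝ k (c ∘ G) (x₀, 0) (fun _ => ((0 : E), (1 : ℝ))) =
        Λ (iteratedFDeriv ℝ k G (x₀, 0) fun _ => ((0 : E), (1 : ℝ))) := by
      rw [c.iteratedFDeriv_comp_left hGs (hle k)]
      rfl
    refine h1.trans ?_
    obtain ⟨k, rfl⟩ : ∃ k', k = k' + 1 := ⟨k - 1, by omega⟩
    exact hΛ (Submodule.subset_span ⟨⟨k, hkN⟩, rfl⟩))
  have hbker : Submodule.span ℝ b ≤ LinearMap.ker Λ := by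
    rw [Submodule.span_le]
    intro z hz
    obtain ⟨m, h1, h2, h3⟩ := hu ⟨z, hz⟩
    have h4 := hker m h1 h2 (e ⟨z, hz⟩)
    rw [hcomp, Equiv.symm_apply_apply, ← h3] at h4
    exact h4
  rw [hbspan] at hbker
  have hall : Submodule.span ℝ {y : F | ∃ m : ℕ, 1 ≤ m ∧ m ≤ l ∧
      ∃ u : Fin m → E, y = iteratedFDeriv ℝ m f x₀ u} ≤ LinearMap.ker Λ := by
    rw [Submodule.span_le]
    rintro _ ⟨m, h1, h2, v, rfl⟩
    have h3 := iteratedFDeriv_eq_zero_of_diag (hcf.of_le (hle m)) (fun w => by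
      rw [hcomp]
      exact hbker (Submodule.subset_span ⟨m, h1, h2, w, rfl⟩)) v
    rw [hcomp] at h3
    exact h3
  exact hΛy (hall hy)

/-- Near a point of nondegeneracy, almost every point has a not very well approximable image. -/
theorem exists_nhds_volume_isVWA_eq_zero {d n : ℕ} {U : Set (Fin d → ℝ)} (hU : IsOpen U)
    {L : AffineSubspace ℝ (Fin n → ℝ)} {f : (Fin d → ℝ) → Fin n → ℝ}
    (hf : ContDiffOn ℝ (⊤ : ℕ∞) f U) (hfL : ∀ x ∈ U, f x ∈ L) {x₀ : Fin d → ℝ} (hx₀ : x₀ ∈ U)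
    (hnd : NondegAt U L f x₀) {y₀ : Fin n → ℝ} (hy₀ : y₀ ∈ L) (hnot : ¬ IsVWA y₀) :
    ∃ V ∈ nhds x₀, volume (V ∩ {x ∈ U | IsVWA (f x)}) = 0 := by
  have hle : ∀ k : ℕ, (k : WithTop ℕ∞) ≤ ((⊤ : ℕ∞) : WithTop ℕ∞) :=
    fun k => by exact_mod_cast le_top
  obtain ⟨l, hl⟩ := hnd
  have hfx : ∀ x ∈ U, ContDiffAt ℝ (⊤ : ℕ∞) f x := fun x hx => hf.contDiffAt (hU.mem_nhds hx)
  obtain ⟨φ, hφ, hφ0, N, hN⟩ := exists_curve_span (hfx x₀ hx₀) l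
  have hset : {y : Fin n → ℝ | ∃ m : ℕ, 1 ≤ m ∧ m ≤ l ∧
        ∃ u : Fin m → (Fin d → ℝ), y = iteratedFDerivWithin ℝ m f U x₀ u} =
      {y | ∃ m : ℕ, 1 ≤ m ∧ m ≤ l ∧
        ∃ u : Fin m → (Fin d → ℝ), y = iteratedFDeriv ℝ m f x₀ u} := by
    simp only [iteratedFDerivWithin_of_isOpen _ hU hx₀]
  rw [← hset, hl] at hN
  set F : (Fin d → ℝ) × ℝ → Fin n → ℝ := fun p => f (p.1 + φ p.2) with hF
  set D : ℕ → (Fin d → ℝ) × ℝ → Fin n → ℝ :=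
    fun k p => iteratedFDeriv ℝ k F p fun _ => ((0 : Fin d → ℝ), (1 : ℝ)) with hD
  have hshift : Continuous fun p : (Fin d → ℝ) × ℝ => p.1 + φ p.2 :=
    continuous_fst.add (hφ.continuous.comp continuous_snd)
  set Ω : Set ((Fin d → ℝ) × ℝ) := {p | p.1 + φ p.2 ∈ U} with hΩ
  have hΩo : IsOpen Ω := hU.preimage hshift
  have hFs : ∀ p ∈ Ω, ContDiffAt ℝ (⊤ : ℕ∞) F p := by
    intro p hp
    exact ContDiffAt.comp p (g := f) (f := fun p : (Fin d → ℝ) × ℝ => p.1 + φ p.2) (hfx _ hp)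
      (contDiff_fst.add (hφ.comp contDiff_snd)).contDiffAt
  have hDdiff : ∀ k, ∀ p ∈ Ω, DifferentiableAt ℝ (iteratedFDeriv ℝ k F) p := fun k p hp =>
    ((hFs p hp).of_le (hle (k + 1))).differentiableAt_iteratedFDeriv
      (by exact_mod_cast Nat.lt_succ_self k)
  have hDcont : ∀ k, ∀ p ∈ Ω, ContinuousAt (D k) p := fun k p hp =>
    ((hDdiff k p hp).continuousMultilinear_apply_const _).continuousAt
  have hDderiv : ∀ k a t, (a, t) ∈ Ω →
      HasDerivAt (fun s => D k (a, s)) (D (k + 1) (a, t)) t := by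
    intro k a t hp
    have h1 := ((hDdiff k _ hp).continuousMultilinear_apply_const
      (fun _ => ((0 : Fin d → ℝ), (1 : ℝ)))).hasFDerivAt
    have h2 : HasDerivAt (fun s : ℝ => (a, s)) ((0 : Fin d → ℝ), (1 : ℝ)) t :=
      (hasDerivAt_const t a).prodMk (hasDerivAt_id t)
    have h3 := h1.comp_hasDerivAt t h2
    have h4 := (hDdiff k _ hp).iteratedFDeriv_succ_apply_left'
      (m := fun _ => ((0 : Fin d → ℝ), (1 : ℝ)))
    have h5 : D (k + 1) (a, t) = fderiv ℝ (fun y => iteratedFDeriv ℝ k F y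
      fun _ => ((0 : Fin d → ℝ), (1 : ℝ))) (a, t) ((0 : Fin d → ℝ), (1 : ℝ)) := h4
    rw [h5]
    exact h3
  obtain ⟨ι, a, ha, haspan, hali⟩ := exists_linearIndependent' ℝ
    fun i : Fin N => D (i + 1) (x₀, 0)
  have : Finite ι := Finite.of_injective a ha
  have : Fintype ι := Fintype.ofFinite ι
  have hp₀ : ((x₀, 0) : (Fin d → ℝ) × ℝ) ∈ Ω := by simpa [hΩ, hφ0] using hx₀
  have hev : ∀ᶠ p in nhds ((x₀, 0) : (Fin d → ℝ) × ℝ),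
      p ∈ Ω ∧ LinearIndependent ℝ fun i : ι => D (a i + 1) p := by
    refine (hΩo.eventually_mem hp₀).and ?_
    have hc : ContinuousAt (fun p => fun i : ι => D (a i + 1) p) (x₀, 0) :=
      continuousAt_pi.2 fun i => hDcont _ _ hp₀
    exact hc.eventually (isOpen_setOfPred_linearIndependent.mem_nhds hali)
  obtain ⟨r, hr, hball⟩ := Metric.eventually_nhds_iff_ball.1 hev
  rw [← haspan] at hN
  have hrank : Module.finrank ℝ L.direction ≤ Fintype.card ι :=
    (Submodule.finrank_mono hN).trans (finrank_range_le_card _)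
  have hmemball : ∀ x ∈ Metric.ball x₀ r, ∀ t, |t| < r →
      ((x, t) : (Fin d → ℝ) × ℝ) ∈ Metric.ball ((x₀, 0) : (Fin d → ℝ) × ℝ) r := by
    intro x hx t ht
    rw [← ball_prod_same]
    exact ⟨hx, by simpa using ht⟩
  have hslice : ∀ x ∈ Metric.ball x₀ r,
      volume {t ∈ Set.Ioo (-r) r | IsVWA (F (x, t))} = 0 := by
    intro x hx
    refine measure_null_of_locally_null _ fun t₀ ht₀ => ?_
    obtain ⟨⟨ht1, ht2⟩, -⟩ := ht₀
    obtain ⟨δ₀, hδ₀, hδ1, hδ2⟩ : ∃ δ₀ : ℝ, 0 < δ₀ ∧ -r < t₀ - δ₀ ∧ t₀ + δ₀ < r := by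
      refine ⟨min (t₀ + r) (r - t₀) / 2, ?_, ?_, ?_⟩
      · have := lt_min (a := (0 : ℝ)) (b := t₀ + r) (c := r - t₀) (by linarith) (by linarith)
        linarith
      · linarith [min_le_left (t₀ + r) (r - t₀)]
      · linarith [min_le_right (t₀ + r) (r - t₀)]
    have hin : ∀ t ∈ Set.Icc (t₀ - δ₀) (t₀ + δ₀),
        ((x, t) : (Fin d → ℝ) × ℝ) ∈ Metric.ball ((x₀, 0) : (Fin d → ℝ) × ℝ) r := by
      intro t ht
      exact hmemball x hx t (abs_lt.2 ⟨by linarith [ht.1], by linarith [ht.2]⟩)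
    have hder : ∀ k, ∀ t ∈ Set.Icc (t₀ - δ₀) (t₀ + δ₀),
        HasDerivAt (fun s => D k (x, s)) (D (k + 1) (x, t)) t :=
      fun k t ht => hDderiv k x t (hball _ (hin t ht)).1
    have hL : ∀ t ∈ Set.Icc (t₀ - δ₀) (t₀ + δ₀), D 0 (x, t) ∈ L :=
      fun t ht => hfL _ (hball _ (hin t ht)).1
    have hdir := deriv_mem_of_sub_mem (D := fun k s => D k (x, s)) (by linarith) hder
      (W := L.direction) (p := y₀) fun t ht => AffineSubspace.vsub_mem_direction (hL t ht) hy₀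
    have ht₀ : t₀ ∈ Set.Icc (t₀ - δ₀) (t₀ + δ₀) := ⟨by linarith, by linarith⟩
    have hsub : Submodule.span ℝ (Set.range fun i : ι => D (a i + 1) (x, t₀)) ≤ L.direction := by
      rw [Submodule.span_le]
      rintro _ ⟨i, rfl⟩
      exact hdir _ t₀ ht₀
    have heq := Submodule.eq_of_le_of_finrank_le hsub (by
      rw [finrank_span_eq_card (hball _ (hin t₀ ht₀)).2]
      exact hrank)
    obtain ⟨δ, hδ, hvol⟩ := exists_volume_isVWA_curve_eq_zero (D := fun k s => D k (x, s))
      (l := N) hδ₀ hder hL (by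
        rw [← heq]
        refine Submodule.span_mono ?_
        rintro _ ⟨i, rfl⟩
        exact ⟨a i, rfl⟩) hy₀ hnot
    refine ⟨Set.Icc (t₀ - δ) (t₀ + δ) ∩ {t ∈ Set.Ioo (-r) r | IsVWA (F (x, t))},
      Filter.inter_mem (mem_nhdsWithin_of_mem_nhds (Icc_mem_nhds (by linarith) (by linarith)))
        self_mem_nhdsWithin, measure_mono_null ?_ hvol⟩
    rintro t ⟨h1, -, h2⟩
    exact ⟨h1, h2⟩
  set A : Set ((Fin d → ℝ) × ℝ) :=
    {p ∈ Metric.ball ((x₀, 0) : (Fin d → ℝ) × ℝ) r | IsVWA (F p)} with hA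
  have hAm : MeasurableSet A := by
    classical
    set s := Metric.ball ((x₀, 0) : (Fin d → ℝ) × ℝ) r
    have hs : MeasurableSet s := Metric.isOpen_ball.measurableSet
    have hFc : ContinuousOn F s := fun p hp => (hFs p (hball p hp).1).continuousAt.continuousWithinAt
    have hm : Measurable (s.piecewise F fun _ => y₀) :=
      hFc.measurable_piecewise continuousOn_const hs
    have e : A = s ∩ (s.piecewise F fun _ => y₀) ⁻¹' {y | IsVWA y} := by
      ext p
      constructor
      · rintro ⟨h1, h2⟩
        exact ⟨h1, by rw [Set.mem_preimage, Set.piecewise_eq_of_mem _ _ _ h1]; exact h2⟩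
      · rintro ⟨h1, h2⟩
        rw [Set.mem_preimage, Set.piecewise_eq_of_mem _ _ _ h1] at h2
        exact ⟨h1, h2⟩
    rw [e]
    exact hs.inter (hm measurableSet_isVWA)
  have hA0 : (volume.prod volume) A = 0 := by
    rw [Measure.measure_prod_null hAm]
    refine Filter.Eventually.of_forall fun x => ?_
    by_cases hx : x ∈ Metric.ball x₀ r
    · refine measure_mono_null ?_ (hslice x hx)
      rintro t ⟨h1, h2⟩
      rw [← ball_prod_same] at h1
      have h3 : |t| < r := by simpa using h1.2
      exact ⟨abs_lt.1 h3, h2⟩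
    · have : Prod.mk x ⁻¹' A = ∅ := by
        ext t
        simp only [Set.mem_preimage, Set.mem_empty_iff_false, iff_false]
        rintro ⟨h1, -⟩
        rw [← ball_prod_same] at h1
        exact hx h1.1
      simp [this]
  rw [Measure.prod_apply_symm hAm,
    lintegral_eq_zero_iff (measurable_measure_prodMk_right hAm)] at hA0
  have hopen : IsOpen {t : ℝ | |t| < r ∧ ‖φ t‖ < r / 2} :=
    (isOpen_lt continuous_abs continuous_const).inter
      (isOpen_lt hφ.continuous.norm continuous_const)
  obtain ⟨t, ⟨ht1, ht2⟩, ht3⟩ := (Measure.dense_of_ae hA0).inter_open_nonempty _ hopen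
    ⟨0, by simpa using hr, by simpa [hφ0] using hr⟩
  refine ⟨Metric.ball x₀ (r / 2), Metric.ball_mem_nhds _ (by linarith), ?_⟩
  have ht4 : volume ((fun x => x + -φ t) ⁻¹' ((fun x => (x, t)) ⁻¹' A)) = 0 := by
    rw [measure_preimage_add_right]
    exact ht3
  refine measure_mono_null ?_ ht4
  rintro x ⟨hx, hxU, hvwa⟩
  refine ⟨hmemball _ ?_ t ht1, ?_⟩
  · rw [mem_ball_iff_norm] at hx ⊢
    have e : x + -φ t - x₀ = (x - x₀) - φ t := by abel
    rw [e]
    exact lt_of_le_of_lt (norm_sub_le _ _) (by linarith)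
  · simpa [hF] using hvwa

/-- A nondegenerate map into an affine subspace containing a not very well approximable point
is extremal. -/
theorem isExtremal_of_not_isVWA {d n : ℕ} {U : Set (Fin d → ℝ)} (hU : IsOpen U)
    {L : AffineSubspace ℝ (Fin n → ℝ)} {f : (Fin d → ℝ) → Fin n → ℝ}
    (hf : ContDiffOn ℝ (⊤ : ℕ∞) f U) (hfL : ∀ x ∈ U, f x ∈ L)
    (hnd : ∀ᵐ x ∂(volume.restrict U), NondegAt U L f x)
    {y₀ : Fin n → ℝ} (hy₀ : y₀ ∈ L) (hnot : ¬ IsVWA y₀) : IsExtremal U f := by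
  rw [ae_restrict_iff' hU.measurableSet] at hnd
  have h1 : volume {x ∈ U | NondegAt U L f x ∧ IsVWA (f x)} = 0 := by
    refine measure_null_of_locally_null _ fun x hx => ?_
    obtain ⟨V, hV, hV0⟩ := exists_nhds_volume_isVWA_eq_zero hU hf hfL hx.1 hx.2.1 hy₀ hnot
    refine ⟨V ∩ {x ∈ U | NondegAt U L f x ∧ IsVWA (f x)},
      Filter.inter_mem (mem_nhdsWithin_of_mem_nhds hV) self_mem_nhdsWithin,
      measure_mono_null ?_ hV0⟩
    rintro z ⟨hz1, hz2, -, hz3⟩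
    exact ⟨hz1, hz2, hz3⟩
  refine measure_mono_null ?_ (measure_union_null hnd h1)
  rintro x ⟨hx, hv⟩
  by_cases h : NondegAt U L f x
  · exact Or.inr ⟨hx, h, hv⟩
  · exact Or.inl fun h' => h (h' hx)

theorem AffineSubspace.exists_affineMap_injective_range_eq {n : ℕ}
    {L : AffineSubspace ℝ (Fin n → ℝ)} {y : Fin n → ℝ} (hy : y ∈ L) :
    ∃ (s : ℕ) (h : (Fin s → ℝ) →ᵃ[ℝ] (Fin n → ℝ)), Function.Injective h ∧
      Set.range h = (L : Set (Fin n → ℝ)) := by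
  let e := (Module.finBasis ℝ L.direction).equivFun.symm
  refine ⟨Module.finrank ℝ L.direction,
    (L.direction.subtype ∘ₗ e.toLinearMap).toAffineMap + AffineMap.const ℝ _ y, ?_, ?_⟩
  · intro a b hab
    exact e.injective (Subtype.ext (add_right_cancel (b := y) hab))
  · ext z
    constructor
    · rintro ⟨a, rfl⟩
      exact AffineSubspace.vadd_mem_of_mem_direction (e a).2 hy
    · intro hz
      refine ⟨e.symm ⟨z - y, AffineSubspace.vsub_mem_direction hz hy⟩, ?_⟩
      simp

theorem nondegAt_affineMap {s n : ℕ} {L : AffineSubspace ℝ (Fin n → ℝ)}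
    {h : (Fin s → ℝ) →ᵃ[ℝ] (Fin n → ℝ)} (hL : Set.range h = (L : Set (Fin n → ℝ)))
    (x : Fin s → ℝ) : NondegAt Set.univ L (fun x => h x) x := by
  have hdir : L.direction = LinearMap.range h.linear := by
    have : L = (⊤ : AffineSubspace ℝ (Fin s → ℝ)).map h := by
      apply SetLike.coe_injective
      simp [← hL]
    rw [this, AffineSubspace.map_direction, AffineSubspace.direction_top, Submodule.map_top]
  have hder : fderiv ℝ (fun x => h x) x = LinearMap.toContinuousLinearMap h.linear := by
    have : (fun x => h x) = fun x => LinearMap.toContinuousLinearMap h.linear x + h 0 := by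
      funext z
      exact congrFun h.decomp z
    rw [this, fderiv_add_const, ContinuousLinearMap.fderiv]
  refine ⟨1, ?_⟩
  have hset : {y : Fin n → ℝ | ∃ m : ℕ, 1 ≤ m ∧ m ≤ 1 ∧
      ∃ u : Fin m → (Fin s → ℝ), y = iteratedFDerivWithin ℝ m (fun x => h x) Set.univ x u} =
      (LinearMap.range h.linear : Set (Fin n → ℝ)) := by
    ext y
    constructor
    · rintro ⟨m, h1, h2, u, rfl⟩
      obtain rfl : m = 1 := le_antisymm h2 h1
      rw [iteratedFDerivWithin_univ, iteratedFDeriv_one_apply, hder]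
      exact ⟨u 0, rfl⟩
    · rintro ⟨v, rfl⟩
      refine ⟨1, le_rfl, le_rfl, fun _ => v, ?_⟩
      rw [iteratedFDerivWithin_univ, iteratedFDeriv_one_apply, hder]
      rfl
  rw [hset, Submodule.span_eq, hdir]

/-- **Theorem 1.2.** (a) If the affine subspace `L ⊆ ℝ^n` is extremal, then any smooth map
`f : U → L`, `U ⊆ ℝ^d` open, which is nondegenerate in `L` is extremal.
(b) If `L` is not extremal, then all points of `L` are VWA. -/
theorem extremal_subspace_inherited (n d : ℕ) (L : AffineSubspace ℝ (Fin n → ℝ)) :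
    (AffineExtremal L →
      ∀ (U : Set (Fin d → ℝ)), IsOpen U →
        ∀ f : (Fin d → ℝ) → Fin n → ℝ, ContDiffOn ℝ (⊤ : ℕ∞) f U →
          (∀ x ∈ U, f x ∈ L) →
          (∀ᵐ x ∂(volume.restrict U), NondegAt U L f x) →
          IsExtremal U f) ∧
    (¬ AffineExtremal L → ∀ y ∈ L, IsVWA y) := by
  constructor
  · intro hL U hU f hf hfL hnd
    rcases U.eq_empty_or_nonempty with rfl | ⟨x, hx⟩
    · simp [IsExtremal]
    obtain ⟨s, h, hinj, hrange⟩ :=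
      AffineSubspace.exists_affineMap_injective_range_eq (hfL x hx)
    have hex := hL s h hinj hrange
    obtain ⟨z, hz⟩ : ∃ z, ¬ IsVWA (h z) := by
      by_contra! hcon
      have huniv : {z ∈ Set.univ | IsVWA (h z)} = Set.univ := by ext z; simp [hcon z]
      rw [IsExtremal, huniv] at hex
      exact isOpen_univ.measure_ne_zero volume Set.univ_nonempty hex
    have hzL : h z ∈ L := by
      rw [← SetLike.mem_coe, ← hrange]
      exact ⟨z, rfl⟩
    exact isExtremal_of_not_isVWA hU hf hfL hnd hzL hz
  · intro hL y hy
    by_contra hnot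
    refine hL fun s h _ hrange => ?_
    refine isExtremal_of_not_isVWA isOpen_univ (L := L) ?_ ?_ ?_ hy hnot
    · have : (fun x => h x) = fun x => LinearMap.toContinuousLinearMap h.linear x + h 0 := by
        funext z
        exact congrFun h.decomp z
      rw [this]
      exact ((ContinuousLinearMap.contDiff _).add contDiff_const).contDiffOn
    · intro x _
      rw [← SetLike.mem_coe, ← hrange]
      exact ⟨x, rfl⟩
    · exact Filter.Eventually.of_forall (nondegAt_affineMap hrange)
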